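/- arXiv:2206.09801 — 2 statements merged into one kernel-verified Lean document; each statement's English description precedes it below -/
import Mathlib

section
/- Let l be an odd prime with l ≡ 3, 5, or 6 (mod 7), and let a ∈ 𝔽_l with a ≠ 0 and a ≠ 1728. Then the degree-8 polynomial F(z,a) ∈ 𝔽_l[z] is squarefree, and the number of distinct monic irreducible factors of F(z,a) over 𝔽_l is odd. -/
open Polynomial

/-- `F(z,a) = (z²-3z+9)(z²-11z+25)³ - a·(z-8)` as a polynomial in `z` over `𝔽_l`. -/
noncomputable def Fza (l : ℕ) [Fact (Nat.Prime l)] (a : ZMod l) : Polynomial (ZMod l) :=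
  (X ^ 2 - 3 * X + 9) * (X ^ 2 - 11 * X + 25) ^ 3 - C a * (X - 8)

lemma sign_sigma {α : Type*} {β : α → Type*} [Fintype α] [DecidableEq α] [∀ a, Fintype (β a)]
    [∀ a, DecidableEq (β a)] (σ : ∀ a, Equiv.Perm (β a)) :
    Equiv.Perm.sign (Equiv.Perm.sigmaCongrRight σ) = ∏ a, Equiv.Perm.sign (σ a) := by
  have key : (Equiv.Perm.sign.comp (Equiv.Perm.sigmaCongrRightHom β)) =
      { toFun := fun σ : ∀ a, Equiv.Perm (β a) => ∏ a, Equiv.Perm.sign (σ a)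
        map_one' := by simp
        map_mul' := by intro x y; simp [Finset.prod_mul_distrib] } := by
    apply MonoidHom.pi_ext
    intro a τ
    simp only [MonoidHom.comp_apply, MonoidHom.coe_mk, OneHom.coe_mk]
    rw [Finset.prod_eq_single a]
    · rw [Pi.mulSingle_eq_same]
      symm
      refine Equiv.Perm.sign_bij (fun x _ => ⟨a, x⟩) ?_ ?_ ?_
      · intro x hx hx'
        simp [Equiv.Perm.sigmaCongrRightHom]
      · intro x y hx hy h
        simpa using h
      · rintro ⟨b, y⟩ hy
        by_cases hb : b = a
        · subst hb
          exact ⟨y, by simpa [Equiv.Perm.sigmaCongrRightHom] using hy, rfl⟩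
        · exfalso; apply hy
          simp [Equiv.Perm.sigmaCongrRightHom, Pi.mulSingle_eq_of_ne hb]
    · intro b _ hb
      simp [Pi.mulSingle_eq_of_ne hb]
    · simp
  exact DFunLike.congr_fun key σ

lemma nonsq (l : ℕ) [Fact (Nat.Prime l)] (hl2 : l ≠ 2)
    (h7 : l % 7 = 3 ∨ l % 7 = 5 ∨ l % 7 = 6) : ¬ IsSquare (-7 : ZMod l) := by
  have hodd : Odd l := (Fact.out : Nat.Prime l).odd_of_ne_two hl2
  have h2 : l % 2 = 1 := Nat.odd_iff.mp hodd
  have hJ : jacobiSym (-7) l = -1 := by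
    rw [jacobiSym.mod_right _ hodd]
    have h28 : l % (4 * (-7 : ℤ).natAbs) = 3 ∨ l % (4 * (-7 : ℤ).natAbs) = 5
      ∨ l % (4 * (-7 : ℤ).natAbs) = 13 ∨ l % (4 * (-7 : ℤ).natAbs) = 17
      ∨ l % (4 * (-7 : ℤ).natAbs) = 19 ∨ l % (4 * (-7 : ℤ).natAbs) = 27 := by
      have : (4 * (-7 : ℤ).natAbs) = 28 := rfl
      rw [this]; omega
    rcases h28 with h | h | h | h | h | h <;> rw [h] <;> norm_num
  have := ZMod.nonsquare_of_jacobiSym_eq_neg_one hJ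
  simpa using this

lemma eq_prod_of_inj {K ι : Type*} [Field K] [Fintype ι] (f : K[X]) (hf : f.Monic) (v : ι → K)
    (hv : Function.Injective v) (hroot : ∀ i, f.eval (v i) = 0) (hc : f.natDegree = Fintype.card ι) :
    f = ∏ i, (X - C (v i)) := by
  apply eq_of_monic_of_dvd_of_natDegree_le (monic_prod_of_monic _ _ fun i _ => monic_X_sub_C _) hf
  · apply Finset.prod_dvd_of_coprime
    · intro i _ j _ hij
      exact pairwise_coprime_X_sub_C hv hij
    · intro i _
      exact dvd_iff_isRoot.mpr (hroot i)
  · rw [hc, natDegree_prod_of_monic _ _ (fun i _ => monic_X_sub_C _)]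
    simp

/-- Frobenius acts on roots with sign determined by the number of factors. -/
lemma frob_perm (l : ℕ) [Fact (Nat.Prime l)] (K : Type) [Field K] [IsAlgClosed K]
    [Algebra (ZMod l) K] (F : (ZMod l)[X]) (hF : F.Monic) (hsq : Squarefree F) (n : ℕ)
    (hn : F.natDegree = n) :
    ∃ (w : Fin n → K) (σ : Equiv.Perm (Fin n)),
      F.map (algebraMap (ZMod l) K) = ∏ i, (X - C (w i)) ∧ (∀ i, w i ^ l = w (σ i)) ∧
      Equiv.Perm.sign σ =
        (-1) ^ (n + {p : Polynomial (ZMod l) | p.Monic ∧ Irreducible p ∧ p ∣ F}.ncard) := by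
  classical
  have : CharP K l := charP_of_injective_algebraMap (algebraMap (ZMod l) K).injective l
  set S : Finset (ZMod l)[X] := (UniqueFactorizationMonoid.normalizedFactors F).toFinset with hS
  have hmem : ∀ p, p ∈ S ↔ Irreducible p ∧ p.Monic ∧ p ∣ F := by
    intro p
    rw [hS, Multiset.mem_toFinset, Polynomial.mem_normalizedFactors_iff hF.ne_zero]
  have hcard : {p : Polynomial (ZMod l) | p.Monic ∧ Irreducible p ∧ p ∣ F}.ncard = S.card := by
    rw [← Set.ncard_coe_finset]
    congr 1
    ext p
    simp only [Set.mem_ofPred_eq, Finset.mem_coe, hmem]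
    tauto
  have hprod : ∏ p ∈ S, p = F := by
    have hnd := (UniqueFactorizationMonoid.squarefree_iff_nodup_normalizedFactors hF.ne_zero).mp hsq
    have h1 : ∏ p ∈ S, p = (UniqueFactorizationMonoid.normalizedFactors F).prod := by
      rw [Finset.prod_eq_multiset_prod, hS, Multiset.toFinset_val, hnd.dedup, Multiset.map_id']
    rw [h1]
    refine eq_of_monic_of_associated ?_ hF
      (UniqueFactorizationMonoid.prod_normalizedFactors hF.ne_zero)
    rw [← h1]
    exact monic_prod_of_monic _ _ fun p hp => ((hmem p).mp hp).2.1
  have hdeg : ∑ p ∈ S, p.natDegree = n := by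
    rw [← hn]
    conv_rhs => rw [← hprod]
    rw [natDegree_prod_of_monic _ _ fun p hp => ((hmem p).mp hp).2.1]
  have hex : ∀ p : S, ∃ x : K, aeval x p.1 = 0 := by
    intro p
    exact IsAlgClosed.exists_aeval_eq_zero K p.1
      (Polynomial.degree_pos_of_irreducible ((hmem p).mp p.2).1).ne'
  choose α hα using hex
  have hirr : ∀ p : S, Irreducible p.1 := fun p => ((hmem p).mp p.2).1
  -- divisibility criterion
  have hdvd : ∀ (p : S) (m : ℕ), α p ^ l ^ m = α p ↔ p.1.natDegree ∣ m := by
    intro p m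
    have h1 := (hirr p).natDegree_dvd_iff_dvd_X_pow_card_pow_sub_X (n := m)
    rw [Nat.card_zmod] at h1
    rw [h1]
    have hmin : p.1 = minpoly (ZMod l) (α p) :=
      minpoly.eq_of_irreducible_of_monic (hirr p) (hα p) ((hmem p).mp p.2).2.1
    rw [hmin, minpoly.dvd_iff, map_sub, map_pow, aeval_X, sub_eq_zero]
  have hinjF : ∀ m : ℕ, Function.Injective (fun x : K => x ^ l ^ m) := by
    intro m
    exact iterateFrobenius_inj K l m
  let v : (Σ p : S, Fin p.1.natDegree) → K := fun x => α x.1 ^ l ^ (x.2 : ℕ)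
  have hvroot : ∀ x, aeval (v x) x.1.1 = 0 := by
    rintro ⟨p, k⟩
    have : ∀ m : ℕ, aeval (α p ^ l ^ m) p.1 = 0 := by
      intro m
      induction m with
      | zero => simpa using hα p
      | succ m ih =>
        have h1 : aeval ((α p ^ l ^ m) ^ l) p.1 = (aeval (α p ^ l ^ m) p.1) ^ l := by
          rw [← map_pow, ← ZMod.expand_card, expand_aeval]
        rw [pow_succ, pow_mul, h1, ih, zero_pow (Fact.out : Nat.Prime l).ne_zero]
    exact this _
  have hv : Function.Injective v := by
    have key : ∀ (p : S) (i j : Fin p.1.natDegree), i ≤ j → v ⟨p, i⟩ = v ⟨p, j⟩ → i = j := by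
      intro p i j hij h
      have h2 : α p ^ l ^ ((j : ℕ) - i) = α p := by
        apply hinjF i
        change (α p ^ l ^ ((j : ℕ) - i)) ^ l ^ (i : ℕ) = α p ^ l ^ (i : ℕ)
        rw [← pow_mul, ← pow_add, Nat.sub_add_cancel hij]
        exact h.symm
      have h3 := (hdvd p _).mp h2
      have h4 := Nat.eq_zero_of_dvd_of_lt h3 (by omega)
      ext
      have : (i : ℕ) ≤ j := hij
      omega
    rintro ⟨p, i⟩ ⟨q, j⟩ h
    have hpq : p = q := by
      apply Subtype.ext
      have h1 := minpoly.eq_of_irreducible_of_monic (hirr p) (hvroot ⟨p, i⟩) ((hmem p).mp p.2).2.1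
      have h2 := minpoly.eq_of_irreducible_of_monic (hirr q) (hvroot ⟨q, j⟩) ((hmem q).mp q.2).2.1
      rw [h1, h2, h]
    subst hpq
    rcases le_total i j with hij | hij
    · rw [key p i j hij h]
    · rw [key p j i hij h.symm]
  let τ : Equiv.Perm (Σ p : S, Fin p.1.natDegree) :=
    Equiv.Perm.sigmaCongrRight fun p => finRotate p.1.natDegree
  have hτ : ∀ x, v x ^ l = v (τ x) := by
    rintro ⟨p, k⟩
    change (α p ^ l ^ (k : ℕ)) ^ l = α p ^ l ^ ((finRotate p.1.natDegree k : Fin _) : ℕ)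
    rw [← pow_mul, ← pow_succ]
    generalize hd : p.1.natDegree = d at k
    have hd0 := hdvd p d
    rw [hd] at hd0
    obtain _ | d := d
    · exact k.elim0
    by_cases hk : (k : ℕ) < d
    · have : k = ⟨k, by omega⟩ := rfl
      rw [this, finRotate_of_lt hk]
    · have hk' : k = Fin.last d := by ext; simp; omega
      rw [hk', finRotate_last]
      simpa using hd0
  have hτs : Equiv.Perm.sign τ = (-1) ^ (n + S.card) := by
    rw [sign_sigma]
    have : ∀ p : S, Equiv.Perm.sign (finRotate p.1.natDegree) = (-1) ^ (p.1.natDegree + 1) := by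
      intro p
      rw [sign_finRotate]
      have := (hirr p).natDegree_pos
      obtain ⟨d, hd⟩ := Nat.exists_eq_succ_of_ne_zero this.ne'
      rw [hd]
      simp [pow_succ]
    rw [Finset.prod_congr rfl fun p _ => this p, Finset.prod_pow_eq_pow_sum,
      Finset.sum_add_distrib, Finset.sum_coe_sort S (fun p => p.natDegree), hdeg]
    simp
  have hcn : Fintype.card (Σ p : S, Fin p.1.natDegree) = n := by
    simp only [Fintype.card_sigma, Fintype.card_fin]
    rw [Finset.sum_coe_sort S (fun p => p.natDegree), hdeg]
  let e := Fintype.equivFinOfCardEq hcn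
  refine ⟨v ∘ e.symm, (e.symm.trans τ).trans e, ?_, ?_, ?_⟩
  · apply eq_prod_of_inj _ (hF.map _)
    · exact hv.comp e.symm.injective
    · intro i
      rw [eval_map_algebraMap]
      obtain ⟨g, hg⟩ := ((hmem _).mp (e.symm i).1.2).2.2
      rw [hg, map_mul]
      have := hvroot (e.symm i)
      simp only [Function.comp]
      rw [this, zero_mul]
    · rw [natDegree_map, hn, Fintype.card_fin]
  · intro i
    simp [hτ]
  · rw [Equiv.Perm.sign_symm_trans_trans, hτs, hcard]

lemma vander_sq {K : Type*} [Field K] (w : Fin 8 → K) (f : K[X]) (hf : f = ∏ i, (X - C (w i))) :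
    (Matrix.vandermonde w).det ^ 2 = ∏ i, (derivative f).eval (w i) := by
  have h1 : ∀ i, (derivative f).eval (w i) = ∏ j ∈ {i}ᶜ, (w i - w j) := by
    intro i
    have := Lagrange.eval_nodal_derivative_eval_node_eq (v := w) (Finset.mem_univ i)
    rw [Lagrange.nodal, ← hf] at this
    rw [this, Lagrange.nodal, eval_prod, Finset.compl_singleton]
    simp
  simp_rw [h1]
  rw [← Finset.prod_prod_Ioi_mul_eq_prod_prod_off_diag (fun j i => w i - w j), Matrix.det_vandermonde]
  simp_rw [Finset.prod_mul_distrib]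
  have h2 : ∏ i : Fin 8, ∏ j > i, (w i - w j) = ∏ i : Fin 8, ∏ j > i, (w j - w i) := by
    have : ∀ i : Fin 8, ∏ j > i, (w i - w j) =
        (-1) ^ (Finset.Ioi i).card * ∏ j > i, (w j - w i) := by
      intro i
      rw [← Finset.prod_const, ← Finset.prod_mul_distrib]
      exact Finset.prod_congr rfl fun j _ => by ring
    rw [Finset.prod_congr rfl fun i _ => this i, Finset.prod_mul_distrib,
      Finset.prod_pow_eq_pow_sum]
    have : ∑ i : Fin 8, (Finset.Ioi i).card = 28 := by decide
    rw [this]; norm_num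
  rw [h2, sq]

lemma fixed (l : ℕ) [Fact (Nat.Prime l)] (K : Type) [Field K] [Algebra (ZMod l) K] (x : K)
    (hx : x ^ l = x) : ∃ c : ZMod l, algebraMap (ZMod l) K c = x := by
  have : CharP K l := charP_of_injective_algebraMap (algebraMap (ZMod l) K).injective l
  have h := (Subfield.mem_bot_iff_pow_eq_self K l).mpr hx
  rw [← ZMod.fieldRange_castHom_eq_bot l] at h
  obtain ⟨c, hc⟩ := h
  exact ⟨c, by rw [← hc]; congr 1; exact Subsingleton.elim _ _⟩

/-- Reciprocity of resultants -/
lemma prod_eval {K : Type*} [Field K] [IsAlgClosed K] (n : ℕ) (hn : Even n) (w : Fin n → K)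
    (F G : K[X]) (hF : F = ∏ i, (X - C (w i))) (hG : G.Monic) (c x : K)
    (hFG : ∀ z, G.eval z = 0 → F.eval z = c * (x - z)) :
    ∏ i, G.eval (w i) = c ^ G.natDegree * G.eval x := by
  have hs := (IsAlgClosed.splits G)
  have hGe : ∀ z, G.eval z = (G.roots.map (fun r => z - r)).prod := by
    intro z
    conv_lhs => rw [hs.eq_prod_roots_of_monic hG]
    rw [eval_multiset_prod, Multiset.map_map]
    simp
  have h1 : ∏ i, G.eval (w i) = (G.roots.map (fun r => F.eval r)).prod := by
    simp_rw [hGe]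
    rw [← Multiset.prod_map_prod]
    congr 1
    apply Multiset.map_congr rfl
    intro r _
    rw [hF, eval_prod]
    simp only [eval_sub, eval_X, eval_C]
    have : ∀ i, w i - r = (-1) * (r - w i) := by intros; ring
    simp_rw [this, Finset.prod_mul_distrib]
    simp [hn.neg_one_pow]
  rw [h1, Multiset.map_congr rfl (fun r hr => hFG r (by simpa using (mem_roots'.mp hr).2)),
    Multiset.prod_map_mul, hGe x]
  simp [hs.natDegree_eq_card_roots]

lemma Fza_eq_one (l : ℕ) [Fact (Nat.Prime l)] (K : Type) [Field K] [Algebra (ZMod l) K]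
    (a : ZMod l) (z : K) : ((Fza l a).map (algebraMap (ZMod l) K)).eval z =
      (z ^ 2 - 3 * z + 9) * (z ^ 2 - 11 * z + 25) ^ 3 - algebraMap (ZMod l) K a * (z - 8) := by
  simp [Fza, Polynomial.map_ofNat]

lemma Fza_deriv (l : ℕ) [Fact (Nat.Prime l)] (K : Type) [Field K] [Algebra (ZMod l) K]
    (a : ZMod l) (z : K) (hz : ((Fza l a).map (algebraMap (ZMod l) K)).eval z = 0) :
    (derivative ((Fza l a).map (algebraMap (ZMod l) K))).eval z * (8 - z) =
      -7 * (z ^ 2 - 11 * z + 25) ^ 2 * (z ^ 4 - 18 * z ^ 3 + 111 * z ^ 2 - 298 * z + 393) := by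
  rw [Fza_eq_one] at hz
  have h : (derivative ((Fza l a).map (algebraMap (ZMod l) K))).eval z =
      (2 * z - 3) * (z ^ 2 - 11 * z + 25) ^ 3 + (z ^ 2 - 3 * z + 9) *
        (3 * (z ^ 2 - 11 * z + 25) ^ 2 * (2 * z - 11)) - algebraMap (ZMod l) K a := by
    simp [Fza, derivative_pow, Polynomial.map_ofNat]
  rw [h]
  linear_combination -hz

lemma Fza_monic (l : ℕ) [Fact (Nat.Prime l)] (a : ZMod l) :
    (Fza l a).Monic ∧ (Fza l a).natDegree = 8 := by
  have h2 : (X ^ 2 - 3 * X + 9 : (ZMod l)[X]).natDegree = 2 := by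
    rw [show (3 : (ZMod l)[X]) = C 3 from rfl, show (9 : (ZMod l)[X]) = C 9 from rfl]
    compute_degree!
  have h2' : (X ^ 2 - 3 * X + 9 : (ZMod l)[X]).Monic := by
    rw [show (3 : (ZMod l)[X]) = C 3 from rfl, show (9 : (ZMod l)[X]) = C 9 from rfl]
    monicity!
  have h3 : (X ^ 2 - 11 * X + 25 : (ZMod l)[X]).natDegree = 2 := by
    rw [show (11 : (ZMod l)[X]) = C 11 from rfl, show (25 : (ZMod l)[X]) = C 25 from rfl]
    compute_degree!
  have h3' : (X ^ 2 - 11 * X + 25 : (ZMod l)[X]).Monic := by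
    rw [show (11 : (ZMod l)[X]) = C 11 from rfl, show (25 : (ZMod l)[X]) = C 25 from rfl]
    monicity!
  have hm := h2'.mul (h3'.pow 3)
  have hd : ((X ^ 2 - 3 * X + 9) * (X ^ 2 - 11 * X + 25) ^ 3 : (ZMod l)[X]).natDegree = 8 := by
    rw [h2'.natDegree_mul (h3'.pow 3), h3'.natDegree_pow, h2, h3]
  have hlt : (C a * (X - 8) : (ZMod l)[X]).degree <
      ((X ^ 2 - 3 * X + 9) * (X ^ 2 - 11 * X + 25) ^ 3 : (ZMod l)[X]).degree := by
    rw [degree_eq_natDegree hm.ne_zero, hd]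
    refine lt_of_le_of_lt (b := 1) ?_ (by norm_num)
    rw [show (8 : (ZMod l)[X]) = C 8 from rfl]
    compute_degree
  refine ⟨hm.sub_of_left hlt, ?_⟩
  rw [Fza, natDegree_eq_of_degree_eq (degree_sub_eq_left_of_degree_lt hlt), hd]

/-- For an odd prime `l ≡ 3, 5, 6 (mod 7)` and `a ∈ 𝔽_l` with `a ≠ 0, 1728`,
the polynomial `F(z,a)` is squarefree and has an odd number of distinct monic
irreducible factors over `𝔽_l`. -/
theorem Fza_squarefree_odd_factors (l : ℕ) [Fact (Nat.Prime l)] (hl2 : l ≠ 2)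
    (h7 : l % 7 = 3 ∨ l % 7 = 5 ∨ l % 7 = 6)
    (a : ZMod l) (ha0 : a ≠ 0) (ha1728 : a ≠ 1728) :
    Squarefree (Fza l a) ∧
      Odd {p : Polynomial (ZMod l) | p.Monic ∧ Irreducible p ∧ p ∣ Fza l a}.ncard := by
  obtain ⟨hmon, hdeg⟩ := Fza_monic l a
  have hns := nonsq l hl2 h7
  have h70 : (7 : ZMod l) ≠ 0 := by
    intro h
    apply hns
    rw [h, neg_zero]
    exact IsSquare.zero
  let K := AlgebraicClosure (ZMod l)
  let φ := algebraMap (ZMod l) K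
  have e7 : φ 7 = 7 := map_ofNat φ 7
  have e1728 : φ 1728 = 1728 := map_ofNat φ 1728
  have h70K : (7 : K) ≠ 0 := by
    have := (map_ne_zero φ).mpr h70
    rwa [e7] at this
  have ha0K : φ a ≠ 0 := (map_ne_zero φ).mpr ha0
  have ha1K : φ a - 1728 ≠ 0 := by
    have := (map_ne_zero φ).mpr (sub_ne_zero.mpr ha1728)
    rwa [map_sub, e1728] at this
  have h8 : ∀ z : K, ((Fza l a).map φ).eval z = 0 → 8 - z ≠ 0 := by
    intro z hz h
    have : z = 8 := (sub_eq_zero.mp h).symm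
    rw [Fza_eq_one, this] at hz
    apply pow_ne_zero 2 h70K
    linear_combination hz
  have hsq : Squarefree (Fza l a) := by
    apply Separable.squarefree
    rw [separable_def, isCoprime_iff_aeval_ne_zero_of_isAlgClosed (ZMod l) K]
    intro z
    by_contra! hcon
    obtain ⟨h1, h2⟩ := hcon
    rw [← eval_map_algebraMap] at h1 h2
    rw [← derivative_map] at h2
    have h3 := Fza_deriv l K a z h1
    have h4 := h8 z h1
    rw [h2, zero_mul] at h3
    rw [Fza_eq_one] at h1
    rcases mul_eq_zero.mp h3.symm with h5 | h5
    · rcases mul_eq_zero.mp h5 with h6 | h6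
      · exact h70K (neg_eq_zero.mp h6)
      · have h6 := pow_eq_zero_iff (two_ne_zero) |>.mp h6
        rw [h6] at h1
        apply mul_ne_zero ha0K h4
        linear_combination h1
    · apply mul_ne_zero ha1K h4
      linear_combination h1 - (z ^ 4 - 18 * z ^ 3 + 111 * z ^ 2 - 298 * z + 393) * h5
  refine ⟨hsq, ?_⟩
  obtain ⟨w, σ, hw, hσ, hsign⟩ := frob_perm l K (Fza l a) hmon hsq 8 hdeg
  set f := (Fza l a).map φ with hf
  have hroot : ∀ i, f.eval (w i) = 0 := by
    intro i
    rw [hw, eval_prod]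
    exact Finset.prod_eq_zero (Finset.mem_univ i) (by simp)
  have hδ2 := vander_sq w f hw
  set δ := (Matrix.vandermonde w).det with hδ
  have hP8 : ∏ i, (8 - w i) = 49 := by
    have : f.eval 8 = 49 := by
      rw [hf, Fza_eq_one]; norm_num
    rw [← this, hw, eval_prod]
    simp
  have hH : ∏ i, (w i ^ 2 - 11 * w i + 25) = φ a ^ 2 := by
    have hd : (X ^ 2 - C 11 * X + C 25 : K[X]).natDegree = 2 := by compute_degree!
    have := prod_eval 8 (by decide) w f (X ^ 2 - C 11 * X + C 25) hw (by monicity!) (φ a) 8 (by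
      intro z hz
      simp only [eval_add, eval_sub, eval_mul, eval_pow, eval_X, eval_C] at hz
      rw [hf, Fza_eq_one, hz]; ring)
    rw [hd] at this
    simp only [eval_add, eval_sub, eval_mul, eval_pow, eval_X, eval_C] at this
    rw [this]; ring
  have hG : ∏ i, (w i ^ 4 - 18 * w i ^ 3 + 111 * w i ^ 2 - 298 * w i + 393) =
      (φ a - 1728) ^ 4 * (-7) := by
    have hd : (X ^ 4 - C 18 * X ^ 3 + C 111 * X ^ 2 - C 298 * X + C 393 : K[X]).natDegree = 4 := by
      compute_degree!
    have := prod_eval 8 (by decide) w f (X ^ 4 - C 18 * X ^ 3 + C 111 * X ^ 2 - C 298 * X + C 393)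
      hw (by monicity!) (φ a - 1728) 8 (by
      intro z hz
      simp only [eval_add, eval_sub, eval_mul, eval_pow, eval_X, eval_C] at hz
      rw [hf, Fza_eq_one]
      linear_combination (z ^ 4 - 18 * z ^ 3 + 111 * z ^ 2 - 298 * z + 393) * hz)
    rw [hd] at this
    simp only [eval_add, eval_sub, eval_mul, eval_pow, eval_X, eval_C] at this
    rw [this]; ring
  have hδ3 : δ ^ 2 * 49 = (-7) ^ 8 * (φ a ^ 2) ^ 2 * ((φ a - 1728) ^ 4 * (-7)) := by
    rw [hδ2, ← hP8, ← hH, ← hG, ← Finset.prod_mul_distrib, ← Finset.prod_pow,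
      Finset.prod_congr rfl fun i _ => Fza_deriv l K a (w i) (hroot i),
      Finset.prod_mul_distrib, Finset.prod_mul_distrib]
    simp
  have hδ4 : δ ^ 2 = -7 * (φ (7 ^ 3 * a ^ 2 * (a - 1728) ^ 2)) ^ 2 := by
    apply mul_right_cancel₀ (pow_ne_zero 2 h70K)
    have : φ (7 ^ 3 * a ^ 2 * (a - 1728) ^ 2) = 7 ^ 3 * φ a ^ 2 * (φ a - 1728) ^ 2 := by
      rw [map_mul, map_mul, map_pow, map_pow, map_pow, map_sub, e7, e1728]
    rw [this]
    linear_combination hδ3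
  have : CharP K l := charP_of_injective_algebraMap (algebraMap (ZMod l) K).injective l
  have hfrob : δ ^ l = (Equiv.Perm.sign σ : ℤ) * δ := by
    have h1 : δ ^ l = frobenius K l δ := rfl
    rw [h1, hδ, RingHom.map_det, ← Matrix.det_permute]
    congr 1
    ext i j
    simp only [RingHom.mapMatrix_apply, Matrix.map_apply, Matrix.vandermonde_apply,
      Matrix.submatrix_apply, id]
    rw [map_pow, frobenius_def, hσ]
  by_contra hodd
  rw [Nat.not_odd_iff_even] at hodd
  have hs1 : Equiv.Perm.sign σ = 1 := by
    rw [hsign]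
    exact Even.neg_one_pow (Even.add (by decide) hodd)
  rw [hs1] at hfrob
  obtain ⟨c, hc⟩ := fixed l K δ (by simpa using hfrob)
  apply hns
  have hs0 : (7 ^ 3 * a ^ 2 * (a - 1728) ^ 2 : ZMod l) ≠ 0 :=
    mul_ne_zero (mul_ne_zero (pow_ne_zero _ h70) (pow_ne_zero _ ha0))
      (pow_ne_zero _ (sub_ne_zero.mpr ha1728))
  generalize (7 ^ 3 * a ^ 2 * (a - 1728) ^ 2 : ZMod l) = s at hs0 hδ4
  have hc2 : c ^ 2 = -7 * s ^ 2 := by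
    apply φ.injective
    rw [map_pow, map_mul, map_pow, map_neg, map_ofNat, ← hδ4, ← hc]
  refine ⟨c / s, ?_⟩
  field_simp
  linear_combination -hc2
end

section
/- Let l be a prime with l ≡ 6 (mod 7), and let j ∈ 𝔽_l with j ≠ 0, j ≠ 1728, and J_l(j) = 0 (that is, j is a supersingular j-invariant in characteristic l). Then the degree-24 polynomial G(x,j) ∈ 𝔽_l[x] has exactly 6 distinct roots in 𝔽_l. -/
open Polynomial

/-- The supersingular polynomial `J_l(j)` of Deuring, evaluated at `j ∈ 𝔽_l`:
`j ≠ 0, 1728` is a supersingular `j`-invariant in characteristic `l > 3` iff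
`J_l(j) = 0`. -/
noncomputable def Jl (l : ℕ) [Fact (Nat.Prime l)] (j : ZMod l) : ZMod l :=
  let s : ℕ := ((1 - legendreSym l (-4)) / 2).toNat
  let n : ℕ := l / 12
  ∑ k ∈ Finset.range (n + 1),
    ((2 * n + s).choose (2 * k + s) : ZMod l) * ((2 * n - 2 * k).choose (n - k) : ZMod l)
      * (-432 : ZMod l) ^ (n - k) * (j - 1728) ^ k

/-- The degree-24 polynomial `G(x,j)`. -/
noncomputable def Gxj (l : ℕ) [Fact (Nat.Prime l)] (j : ZMod l) : Polynomial (ZMod l) :=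
  (X ^ 2 - X + 1) ^ 3 *
      (X ^ 6 + 229 * X ^ 5 + 270 * X ^ 4 - 1695 * X ^ 3 + 1430 * X ^ 2 - 235 * X + 1) ^ 3
    - C j * (X * (X - 1) * (X ^ 3 - 8 * X ^ 2 + 5 * X + 1) ^ 7)

namespace G7

open WeierstrassCurve

/-- short Weierstrass curve -/
def EC {F : Type*} [Field F] (p q : F) : WeierstrassCurve.Affine F :=
  { a₁ := 0, a₂ := 0, a₃ := 0, a₄ := p, a₆ := q }

section
variable {F : Type*} [Field F]

def tM (x A B : F) : F := 3 * x - B ^ 2 / (4 * A)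
def tb (x A B : F) : F := -(tM x A B) ^ 3 / (4 * A)
def tc (x A B : F) : F := 1 - B * tM x A B / (2 * A)
def tor7 (x A B : F) : Prop :=
  A ≠ 0 ∧ tM x A B ≠ 0 ∧ tc x A B ≠ 0 ∧ tb x A B * (tb x A B - tc x A B) = tc x A B ^ 3

lemma EC_eq (p q x y : F) : (EC p q).Equation x y ↔ y ^ 2 = x ^ 3 + p * x + q := by
  simp [Affine.equation_iff, EC]

lemma EC_add [DecidableEq F] {p q x₁ y₁ x₂ y₂ : F} (h₁ : (EC p q).Nonsingular x₁ y₁)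
    (h₂ : (EC p q).Nonsingular x₂ y₂) (hx : x₁ ≠ x₂) (m x₃ y₃ : F) (hm : m * (x₁ - x₂) = y₁ - y₂)
    (hx3 : x₃ = m ^ 2 - x₁ - x₂) (hy3 : y₃ = -(m * (x₃ - x₁) + y₁)) :
    ∃ h, Affine.Point.some x₁ y₁ h₁ + Affine.Point.some x₂ y₂ h₂ = Affine.Point.some x₃ y₃ h := by
  have hs : (EC p q).slope x₁ x₂ y₁ y₂ = m := by
    rw [Affine.slope_of_X_ne hx, ← hm]
    exact mul_div_cancel_right₀ _ (sub_ne_zero.2 hx)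
  have e1 : (EC p q).addX x₁ x₂ m = x₃ := by
    simp [Affine.addX, EC, hx3]
  have e2 : (EC p q).addY x₁ x₂ y₁ m = y₃ := by
    rw [Affine.addY, Affine.negAddY, e1]
    simp [Affine.negY, EC, hy3]
  have := Affine.Point.add_of_X_ne (W := EC p q) (h₁ := h₁) (h₂ := h₂) hx
  simp only [hs, e1, e2] at this
  exact ⟨_, this⟩

lemma EC_dbl [DecidableEq F] {p q x₁ y₁ : F} (h₁ : (EC p q).Nonsingular x₁ y₁)
    (hy : 2 * y₁ ≠ 0) (m x₃ y₃ : F) (hm : m * (2 * y₁) = 3 * x₁ ^ 2 + p)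
    (hx3 : x₃ = m ^ 2 - x₁ - x₁) (hy3 : y₃ = -(m * (x₃ - x₁) + y₁)) :
    ∃ h, Affine.Point.some x₁ y₁ h₁ + Affine.Point.some x₁ y₁ h₁ = Affine.Point.some x₃ y₃ h := by
  have hy' : y₁ ≠ (EC p q).negY x₁ y₁ := by
    simp only [Affine.negY, EC]
    intro h
    apply hy
    linear_combination h
  have hs : (EC p q).slope x₁ x₁ y₁ y₁ = m := by
    rw [Affine.slope_of_Y_ne rfl hy']
    have : y₁ - (EC p q).negY x₁ y₁ = 2 * y₁ := by simp [Affine.negY, EC]; ring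
    rw [this, div_eq_iff hy, hm]
    simp [EC]
  have e1 : (EC p q).addX x₁ x₁ m = x₃ := by
    simp [Affine.addX, EC, hx3]
  have e2 : (EC p q).addY x₁ x₁ y₁ m = y₃ := by
    rw [Affine.addY, Affine.negAddY, e1]
    simp [Affine.negY, EC, hy3]
  have := Affine.Point.add_self_of_Y_ne (W := EC p q) (h₁ := h₁) hy'
  simp only [hs, e1, e2] at this
  exact ⟨_, this⟩

lemma crit [DecidableEq F] {p q x y : F} (h2 : (2 : F) ≠ 0) (h : (EC p q).Nonsingular x y) :
    7 • Affine.Point.some x y h = 0 ↔ tor7 x (x ^ 3 + p * x + q) (3 * x ^ 2 + p) := by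
  set P := Affine.Point.some x y h with hP
  have P0 : P ≠ 0 := Affine.Point.some_ne_zero h
  have heq : y ^ 2 = x ^ 3 + p * x + q := (EC_eq p q x y).1 h.1
  rw [← heq]
  by_cases hy : y = 0
  · constructor
    · intro h7
      exfalso
      apply P0
      have : P + P = 0 := by
        apply Affine.Point.add_self_of_Y_eq
        simp [Affine.negY, EC, hy]
      calc P = 7 • P - 3 • (P + P) := by abel
        _ = 0 := by rw [h7, this]; simp
    · intro ht
      exact absurd (by simp [hy]) ht.1
  have h2y : 2 * y ≠ 0 := mul_ne_zero h2 hy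
  obtain ⟨m, hm⟩ : ∃ m, m * (2 * y) = 3 * x ^ 2 + p := ⟨(3 * x ^ 2 + p) / (2 * y), by field_simp⟩
  have h4 : (4 : F) ≠ 0 := by
    have : (4 : F) = 2 * 2 := by norm_num
    rw [this]; exact mul_ne_zero h2 h2
  obtain ⟨M, hM⟩ : ∃ M, M = 3 * x - m ^ 2 := ⟨_, rfl⟩
  have eM : tM x (y ^ 2) (3 * x ^ 2 + p) = M := by
    rw [tM, ← hm, hM]; field_simp; ring
  have eb : tb x (y ^ 2) (3 * x ^ 2 + p) = - M ^ 3 / (4 * y ^ 2) := by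
    rw [tb, eM]
  have ec : tc x (y ^ 2) (3 * x ^ 2 + p) = (y - m * M) / y := by
    rw [tc, eM, ← hm]; field_simp
  rw [tor7, eM, eb, ec]
  obtain ⟨hn2, e2⟩ := EC_dbl h h2y m _ _ hm rfl rfl
  rw [← hP] at e2
  by_cases hM0 : M = 0
  · constructor
    · intro h7
      exfalso
      apply P0
      have hx2 : m ^ 2 - x - x = x := by linear_combination hM - hM0
      have := (Affine.Point.X_eq_iff (h₁ := hn2) (h₂ := h)).1 hx2
      rw [← e2, ← hP] at this
      rcases this with h' | h'
      · calc P = (P + P) - P := by abel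
          _ = 0 := by rw [h']; abel
      · calc P = 7 • P - 2 • ((P + P) + P) := by abel
          _ = 0 := by rw [h7, h']; simp
    · intro ht; exact absurd hM0 ht.2.1
  have hx2 : x ≠ m ^ 2 - x - x := by
    intro h'; apply hM0; rw [hM]; linear_combination h'
  obtain ⟨u, hu⟩ : ∃ u, u * M = 2 * y := ⟨2 * y / M, by field_simp⟩
  have hu0 : u ≠ 0 := by rintro rfl; apply h2y; rw [← hu]; ring
  have hyu : y = u * M / 2 := by rw [hu]; field_simp
  obtain ⟨hn3, e3⟩ := EC_add h hn2 hx2 (u - m) _ _ (by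
    rw [hyu]; rw [hM]; field_simp; ring) rfl rfl
  rw [← hP, ← e2] at e3
  have hc : (y - m * M) / y = (u - 2 * m) / u := by
    rw [hyu]; field_simp
  rw [hc]
  have hb : - M ^ 3 / (4 * y ^ 2) = - M / u ^ 2 := by
    rw [hyu]; field_simp; ring
  rw [hb]
  have hX3 : (u - m) ^ 2 - x - (m ^ 2 - x - x) = x + u * (u - 2 * m) := by ring
  by_cases hc0 : u - 2 * m = 0
  · constructor
    · intro h7
      exfalso
      apply P0
      have hx3 : (u - m) ^ 2 - x - (m ^ 2 - x - x) = x := by rw [hX3, hc0]; ring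
      have := (Affine.Point.X_eq_iff (h₁ := hn3) (h₂ := h)).1 hx3
      rw [← e3, ← hP] at this
      rcases this with h' | h'
      · calc P = 7 • P - 3 • ((P + (P + P)) - P) := by abel
          _ = 0 := by rw [h7, h']; simp
      · calc P = 2 • ((P + (P + P)) + P) - 7 • P := by abel
          _ = 0 := by rw [h7, h']; simp
    · intro ht; exact absurd (by rw [hc0]; simp) ht.2.2.1
  have hx3 : x ≠ (u - m) ^ 2 - x - (m ^ 2 - x - x) := by
    rw [hX3]; intro h'
    exact mul_ne_zero hu0 hc0 (by linear_combination -h')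
  obtain ⟨hn4, e4⟩ := EC_add h hn3 hx3 (- M / (u - 2 * m) - u + m) _ _ (by
    rw [hX3, hyu]; field_simp; ring) rfl rfl
  rw [← hP, ← e3] at e4
  have key : (- M / (u - 2 * m) - u + m) ^ 2 - x - ((u - m) ^ 2 - x - (m ^ 2 - x - x)) =
      (u - m) ^ 2 - x - (m ^ 2 - x - x) ↔ - M / u ^ 2 * (- M / u ^ 2 - (u - 2 * m) / u) = ((u - 2 * m) / u) ^ 3 := by
    have hx : x = x := rfl
    rw [hX3, ← sub_eq_zero, ← sub_eq_zero (a := - M / u ^ 2 * _)]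
    have h1 : (- M / (u - 2 * m) - u + m) ^ 2 - x - (x + u * (u - 2 * m)) - (x + u * (u - 2 * m)) =
      u ^ 4 / (u - 2 * m) ^ 2 * (- M / u ^ 2 * (- M / u ^ 2 - (u - 2 * m) / u) - ((u - 2 * m) / u) ^ 3) := by
      field_simp
      rw [hM]; ring
    rw [h1, mul_eq_zero]
    have : u ^ 4 / (u - 2 * m) ^ 2 ≠ 0 := div_ne_zero (pow_ne_zero _ hu0) (pow_ne_zero _ hc0)
    tauto
  constructor
  · intro h7
    refine ⟨pow_ne_zero _ hy, hM0, div_ne_zero hc0 hu0, key.1 ?_⟩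
    have h43 : P + (P + (P + P)) = - (P + (P + P)) := by
      rw [eq_neg_iff_add_eq_zero, ← h7]; abel
    rw [e4, e3] at h43
    exact (Affine.Point.X_eq_iff (h₁ := hn4) (h₂ := hn3)).2 (Or.inr h43)
  · intro ht
    have := (Affine.Point.X_eq_iff (h₁ := hn4) (h₂ := hn3)).1 (key.2 ht.2.2.2)
    rw [← e4, ← e3] at this
    rcases this with h' | h'
    · simp at h'
    · calc 7 • P = (P + (P + (P + P))) + (P + (P + P)) := by abel
        _ = 0 := by rw [h']; abel
end

section
variable {F : Type*} [Field F]

def qq (x : F) : F := x ^ 2 - x + 1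
def sex (x : F) : F :=
  x ^ 6 + 229 * x ^ 5 + 270 * x ^ 4 - 1695 * x ^ 3 + 1430 * x ^ 2 - 235 * x + 1
def six (x : F) : F := x ^ 6 - 11 * x ^ 5 + 30 * x ^ 4 - 15 * x ^ 3 - 10 * x ^ 2 + 5 * x + 1
def cub (x : F) : F := x ^ 3 - 8 * x ^ 2 + 5 * x + 1
def Groot (j x : F) : Prop := qq x ^ 3 * sex x ^ 3 = j * (x * (x - 1) * cub x ^ 7)
def R1 (j d : F) : Prop := (qq d * six d) ^ 3 = j * (d ^ 7 * (d - 1) ^ 7 * cub d)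
def Wm (a x : F) : F := (a * x - a + 1) / (x - a)

lemma cub_q {a : F} (h7 : (7 : F) ≠ 0) (ha : cub a = 0) : qq a ≠ 0 := by
  intro h
  unfold qq at h
  unfold cub at ha
  have : (7 : F) ^ 2 = 0 := by
    linear_combination (44 + 16 * a - 3 * a ^ 2) * h - (-5 - 3 * a) * ha
  exact pow_ne_zero _ h7 this

lemma cub_six {a : F} (ha : cub a = 0) : six a ≠ 0 := by
  intro h
  unfold six at h
  unfold cub at ha
  have : (1 : F) = 0 := by
    linear_combination (37 + 46 * a - 7 * a ^ 2) * h - ((36)*a^0 + (51)*a^1 + (-114)*a^2 + (-108)*a^3 + (67)*a^4 + (-7)*a^5) * ha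
  exact one_ne_zero this

lemma cub_sex {a : F} (h7 : (7 : F) ≠ 0) (ha : cub a = 0) : sex a ≠ 0 := by
  intro h
  unfold sex at h
  unfold cub at ha
  have : (7 : F) ^ 4 = 0 := by
    linear_combination (37 + 46 * a - 7 * a ^ 2) * h - ((-2364)*a^0 + (3171)*a^1 + (7326)*a^2 + (-4188)*a^3 + (-1613)*a^4 + (-7)*a^5) * ha
  exact pow_ne_zero _ h7 this

lemma G_ne {a j : F} (h7 : (7 : F) ≠ 0) (ha : cub a = 0) : ¬ Groot j a := by
  intro h
  have : qq a ^ 3 * sex a ^ 3 = 0 := by rw [h, ha]; ring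
  exact mul_ne_zero (pow_ne_zero _ (cub_q h7 ha)) (pow_ne_zero _ (cub_sex h7 ha)) this

lemma R1_ne {a j : F} (h7 : (7 : F) ≠ 0) (ha : cub a = 0) : ¬ R1 j a := by
  intro h
  have : (qq a * six a) ^ 3 = 0 := by rw [h, ha]; ring
  exact pow_ne_zero _ (mul_ne_zero (cub_q h7 ha) (cub_six ha)) this

lemma cub_ne {a : F} (ha : cub a = 0) : a * (a - 1) ≠ 0 := by
  intro h
  unfold cub at ha
  rcases mul_eq_zero.1 h with h | h
  · rw [h] at ha; simp at ha
  · rw [sub_eq_zero.1 h] at ha; norm_num at ha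

lemma Wm_ne {a x : F} (h7 : (7 : F) ≠ 0) (ha : cub a = 0) (hx : x ≠ a) : Wm a x ≠ a := by
  intro h
  rw [Wm, div_eq_iff (sub_ne_zero.2 hx)] at h
  apply cub_q h7 ha
  unfold qq; linear_combination h

lemma Wm_Wm {a x : F} (h7 : (7 : F) ≠ 0) (ha : cub a = 0) (hx : x ≠ a) : Wm a (Wm a x) = x := by
  have h1 := sub_ne_zero.2 (Wm_ne h7 ha hx)
  have h2 := sub_ne_zero.2 hx
  rw [Wm, div_eq_iff h1, Wm]
  field_simp
  ring

lemma G_iff_R1 {a j x : F} (h7 : (7 : F) ≠ 0) (ha : cub a = 0) (hx : x ≠ a) :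
    Groot j x ↔ R1 j (Wm a x) := by
  have he := sub_ne_zero.2 hx
  obtain ⟨w, hw⟩ : ∃ w, w = Wm a x := ⟨_, rfl⟩
  rw [← hw]
  have hn : w * (x - a) = a * x - a + 1 := by
    rw [hw, Wm]; field_simp
  have ha' := ha
  unfold cub at ha'
  have e1 : qq w * (x - a) ^ 2 = (a ^ 2 - a + 1) * qq x := by
    have : qq w * (x - a) ^ 2 = (w * (x - a)) ^ 2 - (w * (x - a)) * (x - a) + (x - a) ^ 2 := by
      unfold qq; ring
    rw [this, hn]; unfold qq; ring
  have e2 : six w * (x - a) ^ 6 = (-6 - 31 * a + 44 * a ^ 2) * sex x := by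
    have : six w * (x - a) ^ 6 = (w * (x - a)) ^ 6 - 11 * (w * (x - a)) ^ 5 * (x - a)
       + 30 * (w * (x - a)) ^ 4 * (x - a) ^ 2 - 15 * (w * (x - a)) ^ 3 * (x - a) ^ 3
       - 10 * (w * (x - a)) ^ 2 * (x - a) ^ 4 + 5 * (w * (x - a)) * (x - a) ^ 5
       + (x - a) ^ 6 := by
      unfold six; ring
    rw [this, hn]; unfold sex
    linear_combination (x^0*((7)*a^0 + (1)*a^1 + (-3)*a^2 + (1)*a^3) + x^1*((-1421)*a^0 + (-179)*a^1 + (-23)*a^2 + (-11)*a^3) + x^2*((8610)*a^0 + (1150)*a^1 + (190)*a^2 + (30)*a^3) + x^3*((-10185)*a^0 + (-1415)*a^1 + (-235)*a^2 + (-15)*a^3) + x^4*((1610)*a^0 + (270)*a^1 + (30)*a^2 + (-10)*a^3) + x^5*((1379)*a^0 + (173)*a^1 + (41)*a^2 + (5)*a^3) + x^6*((7)*a^0 + (1)*a^1 + (-3)*a^2 + (1)*a^3)) * ha'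
  have e3 : cub w * (x - a) ^ 3 = 49 * (a * (a - 1)) * (x * (x - 1)) := by
    have : cub w * (x - a) ^ 3 = (w * (x - a)) ^ 3 - 8 * (w * (x - a)) ^ 2 * (x - a)
       + 5 * (w * (x - a)) * (x - a) ^ 2 + (x - a) ^ 3 := by
      unfold cub; ring
    rw [this, hn]
    linear_combination (1 - 8 * x + 5 * x ^ 2 + x ^ 3) * ha'
  have e4 : w * (w - 1) * (x - a) ^ 3 = a * (a - 1) * cub x := by
    have : w * (w - 1) * (x - a) ^ 3 = (w * (x - a)) * (w * (x - a) - (x - a)) * (x - a) := by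
      ring
    rw [this, hn]; unfold cub
    linear_combination (x - x ^ 2) * ha'
  have e5 : ((a ^ 2 - a + 1) * (-6 - 31 * a + 44 * a ^ 2)) ^ 3 = 49 * (a * (a - 1)) ^ 8 := by
    linear_combination ((-216)*a^0 + (-1620)*a^1 + (2574)*a^2 + (12761)*a^3 + (-60664)*a^4 + (131034)*a^5 + (-176530)*a^6 + (161886)*a^7 + (-99774)*a^8 + (37605)*a^9 + (-6223)*a^10 + (-1127)*a^11 + (-49)*a^13) * ha'
  have hu : 49 * (a * (a - 1)) ^ 8 ≠ 0 := by
    have : (49 : F) = 7 ^ 2 := by norm_num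
    rw [this]
    exact mul_ne_zero (pow_ne_zero _ h7) (pow_ne_zero _ (cub_ne ha))
  have L : (qq w * six w) ^ 3 * (x - a) ^ 24 =
      49 * (a * (a - 1)) ^ 8 * (qq x ^ 3 * sex x ^ 3) := by
    calc _ = ((qq w * (x - a) ^ 2) * (six w * (x - a) ^ 6)) ^ 3 := by ring
      _ = ((a ^ 2 - a + 1) * (-6 - 31 * a + 44 * a ^ 2)) ^ 3 * (qq x ^ 3 * sex x ^ 3) := by
        rw [e1, e2]; ring
      _ = _ := by rw [e5]
  have R : j * (w ^ 7 * (w - 1) ^ 7 * cub w) * (x - a) ^ 24 =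
      49 * (a * (a - 1)) ^ 8 * (j * (x * (x - 1) * cub x ^ 7)) := by
    calc _ = j * ((w * (w - 1) * (x - a) ^ 3) ^ 7 * (cub w * (x - a) ^ 3)) := by ring
      _ = _ := by rw [e3, e4]; ring
  unfold Groot R1
  constructor
  · intro h
    apply mul_right_cancel₀ (pow_ne_zero 24 he)
    rw [L, R, h]
  · intro h
    apply mul_left_cancel₀ hu
    rw [← L, ← R, h]

/-- invariants of the Tate curve -/
def b2 (d : F) : F := (1 - (d ^ 2 - d)) ^ 2 - 4 * (d ^ 3 - d ^ 2)
def b4 (d : F) : F := - (1 - (d ^ 2 - d)) * (d ^ 3 - d ^ 2)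
def c4 (d : F) : F := qq d * six d
def c6 (d : F) : F := - b2 d ^ 3 + 36 * b2 d * b4 d - 216 * (d ^ 3 - d ^ 2) ^ 2
def D7 (d : F) : F := d ^ 7 * (d - 1) ^ 7 * cub d

lemma c4_eq (d : F) : c4 d = b2 d ^ 2 - 24 * b4 d := by
  unfold c4 b2 b4 qq six; ring

lemma c46 (d : F) : c4 d ^ 3 - c6 d ^ 2 = 1728 * D7 d := by
  unfold c6 D7 c4 b2 b4 qq six cub; ring

lemma d_of_T {j k x : F} (h2 : (2 : F) ≠ 0) (h3 : (3 : F) ≠ 0)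
    (hk0 : k ≠ 0) (hk : k * (1728 - j) = j)
    (h : tor7 x (x ^ 3 + 3 * k * x + 2 * k) (3 * x ^ 2 + 3 * k)) :
    let d := tb x (x ^ 3 + 3 * k * x + 2 * k) (3 * x ^ 2 + 3 * k) /
        tc x (x ^ 3 + 3 * k * x + 2 * k) (3 * x ^ 2 + 3 * k)
    R1 j d ∧ x = b2 d * c4 d / c6 d := by
  intro d
  obtain ⟨hA, hM, hc, hbc⟩ := h
  set A := x ^ 3 + 3 * k * x + 2 * k with hAd
  set B := 3 * x ^ 2 + 3 * k with hBd
  have hd : d = tb x A B / tc x A B := rfl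
  have hb' : tb x A B = tc x A B * d := by rw [hd]; field_simp
  have hc' : tc x A B = d ^ 2 - d := by
    rw [hb'] at hbc
    apply mul_left_cancel₀ (pow_ne_zero 2 hc)
    linear_combination -hbc
  have hb'' : tb x A B = d ^ 3 - d ^ 2 := by rw [hb', hc']; ring
  clear_value d
  clear hd hb' hbc
  have h4 : (4 : F) ≠ 0 := by
    have : (4 : F) = 2 * 2 := by norm_num
    rw [this]; exact mul_ne_zero h2 h2
  obtain ⟨M, hMd⟩ : ∃ M, M = tM x A B := ⟨_, rfl⟩
  rw [← hMd] at hM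
  have f1 : 4 * A * M = 12 * A * x - B ^ 2 := by
    rw [hMd, tM]; field_simp
    ring
  obtain ⟨v, hv⟩ : ∃ v, v * M ^ 2 = 4 * A := ⟨4 * A / M ^ 2, by field_simp⟩
  have hv0 : v ≠ 0 := by
    rintro rfl; exact mul_ne_zero h4 hA (by rw [← hv]; ring)
  -- M = -v b
  have g1 : M = - v * (d ^ 3 - d ^ 2) := by
    rw [← hb'', tb, ← hMd, ← hv]; field_simp
  have g2 : B * M = 2 * A * (1 - (d ^ 2 - d)) := by
    rw [← hc', tc, ← hMd]; field_simp
    ring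
  have hbn : d ^ 3 - d ^ 2 ≠ 0 := by
    intro h0; apply hM; rw [g1, h0]; ring
  have gA : 4 * A = v ^ 3 * (d ^ 3 - d ^ 2) ^ 2 := by rw [← hv, g1]; ring
  have gB : 2 * B = v ^ 2 * b4 d := by
    apply mul_left_cancel₀ hM
    calc M * (2 * B) = 2 * (B * M) := by ring
      _ = (4 * A) * (1 - (d ^ 2 - d)) := by rw [g2]; ring
      _ = M * (v ^ 2 * b4 d) := by rw [gA, g1]; unfold b4; ring
  have gx : 12 * x = v * b2 d := by
    have : 4 * A ≠ 0 := mul_ne_zero h4 hA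
    apply mul_left_cancel₀ this
    have e : 4 * A * (12 * x) = 4 * (4 * A * M) + (2 * B) ^ 2 := by rw [f1]; ring
    rw [e, gB]
    rw [gA, g1]; unfold b4 b2; ring
  have p1 : - (144 * k) = v ^ 2 * c4 d := by
    rw [c4_eq]
    linear_combination (exp := 1) (-24) * gB + (12 * x + v * b2 d) * gx + 48 * hBd
  have p2 : - (1728 * k) = v ^ 3 * c6 d := by
    unfold c6
    linear_combination (-216) * gA + (36 * v * b2 d) * gB - (144 * x ^ 2 + 12 * x * v * b2 d + v ^ 2 * b2 d ^ 2 - 72 * B) * gx - 864 * x * hBd + 864 * hAd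
  have h144 : (144 : F) ≠ 0 := by
    have : (144 : F) = 2 ^ 4 * 3 ^ 2 := by norm_num
    rw [this]; exact mul_ne_zero (pow_ne_zero _ h2) (pow_ne_zero _ h3)
  have h1728 : (1728 : F) ≠ 0 := by
    have : (1728 : F) = 2 ^ 6 * 3 ^ 3 := by norm_num
    rw [this]; exact mul_ne_zero (pow_ne_zero _ h2) (pow_ne_zero _ h3)
  have h12 : (12 : F) ≠ 0 := by
    have : (12 : F) = 2 ^ 2 * 3 := by norm_num
    rw [this]; exact mul_ne_zero (pow_ne_zero _ h2) h3
  have hc60 : c6 d ≠ 0 := by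
    intro h0; rw [h0] at p2
    exact mul_ne_zero h1728 hk0 (by linear_combination -p2)
  constructor
  · show c4 d ^ 3 = j * D7 d
    apply mul_left_cancel₀ (mul_ne_zero h1728 (pow_ne_zero 6 hv0))
    have := c46 d
    have e1 : v ^ 6 * c4 d ^ 3 = (- (144 * k)) ^ 3 := by rw [p1]; ring
    have e2 : v ^ 6 * c6 d ^ 2 = (- (1728 * k)) ^ 2 := by rw [p2]; ring
    linear_combination (1728 - j) * e1 + j * e2 - 2985984 * k ^ 2 * hk + j * v ^ 6 * this
  · rw [eq_div_iff hc60]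
    apply mul_left_cancel₀ (mul_ne_zero h12 (pow_ne_zero 3 hv0))
    linear_combination (v ^ 3 * c6 d) * gx - v * b2 d * p2 + 12 * v * b2 d * p1

lemma T_of_d {j k d : F} (h2 : (2 : F) ≠ 0) (h3 : (3 : F) ≠ 0) (h7 : (7 : F) ≠ 0)
    (hj0 : j ≠ 0) (hj : j ≠ 1728) (hk0 : k ≠ 0) (hk : k * (1728 - j) = j)
    (h : R1 j d) :
    let x := b2 d * c4 d / c6 d
    tor7 x (x ^ 3 + 3 * k * x + 2 * k) (3 * x ^ 2 + 3 * k) ∧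
      tb x (x ^ 3 + 3 * k * x + 2 * k) (3 * x ^ 2 + 3 * k) /
        tc x (x ^ 3 + 3 * k * x + 2 * k) (3 * x ^ 2 + 3 * k) = d := by
  intro x
  have hD : c4 d ^ 3 = j * D7 d := h
  have h4 : (4 : F) ≠ 0 := by
    have : (4 : F) = 2 * 2 := by norm_num
    rw [this]; exact mul_ne_zero h2 h2
  have h12 : (12 : F) ≠ 0 := by
    have : (12 : F) = 2 ^ 2 * 3 := by norm_num
    rw [this]; exact mul_ne_zero (pow_ne_zero _ h2) h3
  have d0 : d ≠ 0 := by
    rintro rfl; simp [c4, qq, six, D7] at hD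
  have d1 : d ≠ 1 := by
    rintro rfl; simp [c4, qq, six, D7] at hD; norm_num at hD
  have hcub : cub d ≠ 0 := fun h0 => R1_ne h7 h0 h
  have hD0 : D7 d ≠ 0 := mul_ne_zero (mul_ne_zero (pow_ne_zero _ d0)
    (pow_ne_zero _ (sub_ne_zero.2 d1))) hcub
  have hc40 : c4 d ≠ 0 := by
    intro h0; rw [h0] at hD
    exact mul_ne_zero hj0 hD0 (by rw [← hD]; ring)
  have hc6 : c6 d ^ 2 = (j - 1728) * D7 d := by linear_combination hD - c46 d
  have hc60 : c6 d ≠ 0 := by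
    intro h0; rw [h0] at hc6
    exact mul_ne_zero (sub_ne_zero.2 hj) hD0 (by rw [← hc6]; ring)
  obtain ⟨v, hv⟩ : ∃ v, v * c6 d = 12 * c4 d := ⟨12 * c4 d / c6 d, by field_simp⟩
  have hv0 : v ≠ 0 := by
    rintro rfl; exact mul_ne_zero h12 hc40 (by rw [← hv]; ring)
  have gx : 12 * x = v * b2 d := by
    have : x * c6 d = b2 d * c4 d := div_mul_cancel₀ _ hc60
    apply mul_right_cancel₀ hc60
    linear_combination 12 * this - b2 d * hv
  clear_value x
  have hk' : k * c6 d ^ 2 = - c4 d ^ 3 := by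
    rw [hc6, hD]; linear_combination -D7 d * hk
  have p1 : - (144 * k) = v ^ 2 * c4 d := by
    apply mul_right_cancel₀ (pow_ne_zero 2 hc60)
    linear_combination (-144) * hk' - c4 d * (v * c6 d + 12 * c4 d) * hv
  have p2 : - (1728 * k) = v ^ 3 * c6 d := by
    linear_combination 12 * p1 - v ^ 2 * hv
  have h1728 : (1728 : F) ≠ 0 := by
    have : (1728 : F) = 2 ^ 6 * 3 ^ 3 := by norm_num
    rw [this]; exact mul_ne_zero (pow_ne_zero _ h2) (pow_ne_zero _ h3)
  obtain ⟨A, hAd⟩ : ∃ A, A = x ^ 3 + 3 * k * x + 2 * k := ⟨_, rfl⟩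
  obtain ⟨B, hBd⟩ : ∃ B, B = 3 * x ^ 2 + 3 * k := ⟨_, rfl⟩
  rw [← hAd, ← hBd]
  have gB : 2 * B = v ^ 2 * b4 d := by
    have h24 : (24 : F) ≠ 0 := by
      have : (24 : F) = 2 * 12 := by norm_num
      rw [this]; exact mul_ne_zero h2 h12
    apply mul_left_cancel₀ h24
    rw [c4_eq] at p1
    linear_combination 48 * hBd - p1 + (12 * x + v * b2 d) * gx
  have gA : 4 * A = v ^ 3 * (d ^ 3 - d ^ 2) ^ 2 := by
    have h216 : (216 : F) ≠ 0 := by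
      have : (216 : F) = 2 ^ 3 * 3 ^ 3 := by norm_num
      rw [this]; exact mul_ne_zero (pow_ne_zero _ h2) (pow_ne_zero _ h3)
    apply mul_left_cancel₀ h216
    unfold c6 at p2
    linear_combination (-1) * p2 + (36 * v * b2 d) * gB - (144 * x ^ 2 + 12 * x * v * b2 d + v ^ 2 * b2 d ^ 2 - 72 * B) * gx - 864 * x * hBd + 864 * hAd
  have hbn : d ^ 3 - d ^ 2 ≠ 0 := by
    have : d ^ 3 - d ^ 2 = d ^ 2 * (d - 1) := by ring
    rw [this]; exact mul_ne_zero (pow_ne_zero _ d0) (sub_ne_zero.2 d1)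
  have hcn : d ^ 2 - d ≠ 0 := by
    have : d ^ 2 - d = d * (d - 1) := by ring
    rw [this]; exact mul_ne_zero d0 (sub_ne_zero.2 d1)
  have hA0 : 4 * A ≠ 0 := by
    rw [gA]; exact mul_ne_zero (pow_ne_zero _ hv0) (pow_ne_zero _ hbn)
  have hA : A ≠ 0 := fun h0 => hA0 (by rw [h0]; ring)
  have hM : tM x A B = - v * (d ^ 3 - d ^ 2) := by
    have e : 4 * (4 * A) * (tM x A B) = (4 * A) * (12 * x) - (2 * B) ^ 2 := by
      rw [tM]; field_simp; ring
    apply mul_left_cancel₀ (mul_ne_zero h4 hA0)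
    rw [e, gB, gA, gx]; unfold b4 b2; ring
  have hb : tb x A B = d ^ 3 - d ^ 2 := by
    rw [tb, hM, gA]; field_simp
  have hc : tc x A B = d ^ 2 - d := by
    have : tc x A B = 1 - (2 * B) * tM x A B / (4 * A) := by
      rw [tc]; field_simp; ring
    rw [this, hM, gA, gB]; unfold b4; field_simp; ring
  refine ⟨⟨hA, ?_, ?_, ?_⟩, ?_⟩
  · rw [hM]; exact mul_ne_zero (neg_ne_zero.2 hv0) hbn
  · rw [hc]; exact hcn
  · rw [hc, hb]; ring
  · rw [hc, hb, div_eq_iff hcn]; ring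
end


section count
variable {l : ℕ} [Fact l.Prime]

lemma sum_pow_zero (hl : 3 ≤ l) (i : ℕ) (hi : i ≠ l - 1) (hi2 : i < 2 * (l - 1)) :
    ∑ x : ZMod l, x ^ i = 0 := by
  have hc : Fintype.card (ZMod l) = l := ZMod.card l
  rcases lt_or_gt_of_ne hi with h | h
  · exact FiniteField.sum_pow_lt_card_sub_one _ i (by rw [hc]; exact h)
  · have : ∀ x : ZMod l, x ^ i = x ^ (i - l + 1) := by
      intro x
      have e : i = l + (i - l) := by omega
      conv_lhs => rw [e, pow_add, ZMod.pow_card]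
      rw [pow_succ, mul_comm]
    simp_rw [this]
    exact FiniteField.sum_pow_lt_card_sub_one _ _ (by rw [hc]; omega)

lemma sum_poly (hl : 3 ≤ l) (g : (ZMod l)[X]) (hg : g.natDegree < 2 * (l - 1))
    (h0 : g.coeff (l - 1) = 0) : ∑ x : ZMod l, g.eval x = 0 := by
  simp_rw [Polynomial.eval_eq_sum_range]
  rw [Finset.sum_comm]
  apply Finset.sum_eq_zero
  intro i hi
  rw [← Finset.mul_sum]
  by_cases h : i = l - 1
  · rw [h, h0, zero_mul]
  · rw [sum_pow_zero hl i h, mul_zero]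
    have := Finset.mem_range.1 hi
    omega

noncomputable def fP (p q : ZMod l) : (ZMod l)[X] := X ^ 3 + C p * X + C q

lemma fP_deg (p q : ZMod l) : (fP p q).natDegree = 3 := by
  unfold fP; compute_degree!

lemma fP_monic (p q : ZMod l) : (fP p q).Monic := by
  unfold fP; monicity!

lemma fP_eval (p q x : ZMod l) : (fP p q).eval x = x ^ 3 + p * x + q := by
  simp [fP]

/-- `f^m` is not constant on `𝔽_l` -/
lemma not_const (hl : 13 ≤ l) (p q ε : ZMod l)
    (h : ∀ x : ZMod l, (fP p q).eval x ^ (l / 2) = ε) : False := by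
  set f := fP p q with hf
  set m := l / 2 with hm
  have hodd : l % 2 = 1 := (Nat.Prime.eq_two_or_odd (Fact.out : l.Prime)).resolve_left (by omega)
  have hfd : f.natDegree = 3 := fP_deg p q
  have hfm : f.Monic := fP_monic p q
  have hfmd : (f ^ m).natDegree = m * 3 := by rw [hfm.natDegree_pow, hfd]
  have hdvd : (X ^ l - X : (ZMod l)[X]) ∣ f ^ m - C ε := by
    have hc : Fintype.card (ZMod l) = l := ZMod.card l
    have hroots := FiniteField.roots_X_pow_card_sub_X (ZMod l)
    have hdeg := FiniteField.X_pow_card_sub_X_natDegree_eq (ZMod l) (p := l) (by omega : 1 < l)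
    rw [hc] at hroots
    have hmon : (X ^ l - X : (ZMod l)[X]).Monic := by
      apply monic_X_pow_sub
      rw [degree_X]; exact_mod_cast (by omega : 1 < l)
    have hprod : ∏ a : ZMod l, (X - C a) = (X ^ l - X : (ZMod l)[X]) := by
      have := prod_multiset_X_sub_C_of_monic_of_roots_card_eq hmon (by
        rw [hroots, hdeg]; exact hc)
      rw [hroots] at this
      exact this
    rw [← hprod]
    apply Finset.prod_dvd_of_coprime
    · intro a _ b _ hab
      exact pairwise_coprime_X_sub_C Function.injective_id hab
    · intro a _
      rw [dvd_iff_isRoot]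
      simp [IsRoot, h]
  obtain ⟨g, hg⟩ := hdvd
  have hXl : (X ^ l - X : (ZMod l)[X]).natDegree = l :=
    FiniteField.X_pow_card_sub_X_natDegree_eq (ZMod l) (by omega)
  have hXl0 : (X ^ l - X : (ZMod l)[X]) ≠ 0 := by
    intro h0; rw [h0] at hXl; simp at hXl; omega
  have hg0 : g ≠ 0 := by
    rintro rfl
    rw [mul_zero, sub_eq_zero] at hg
    rw [hg, natDegree_C] at hfmd
    omega
  have hgd : l + g.natDegree = m * 3 := by
    rw [← hfmd, ← natDegree_sub_C (p := f ^ m) (a := ε), hg, natDegree_mul hXl0 hg0, hXl]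
  -- derivative
  have hder : C (m : ZMod l) * f ^ (m - 1) * derivative f =
      - g + (X ^ l - X) * derivative g := by
    have := congrArg derivative hg
    simp only [derivative_sub, derivative_C, derivative_mul, derivative_X,
      derivative_pow, sub_zero] at this
    simp only [CharP.cast_eq_zero, map_zero, zero_mul, zero_sub] at this
    rw [this]; ring
  have hm1 : f ^ m = f * f ^ (m - 1) := by
    rw [← pow_succ']; congr 1; omega
  have hkey : (X ^ l - X) * (C (m : ZMod l) * derivative f * g - f * derivative g) =
      - (f * g) - C ε * C (m : ZMod l) * derivative f := by
    have e1 : f ^ m = C ε + (X ^ l - X) * g := by rw [← hg]; ring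
    have e2 : f * (C (m : ZMod l) * f ^ (m - 1) * derivative f) =
       C (m : ZMod l) * f ^ m * derivative f := by rw [hm1]; ring
    rw [hder, e1] at e2
    linear_combination -e2
  have hdf : (derivative f).natDegree ≤ 2 := by
    have := natDegree_derivative_le f
    rw [hfd] at this; exact this
  have hfg : (f * g).natDegree = 3 + g.natDegree := by
    rw [natDegree_mul hfm.ne_zero hg0, hfd]
  have hrhs : (C ε * C (m : ZMod l) * derivative f).natDegree ≤ 2 := by
    rw [← C_mul]
    exact (natDegree_C_mul_le _ _).trans hdf
  have hR0 : - (f * g) - C ε * C (m : ZMod l) * derivative f ≠ 0 := by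
    intro h0
    have : f * g = - (C ε * C (m : ZMod l) * derivative f) := by linear_combination -h0
    have h1 := congrArg natDegree this
    rw [natDegree_neg, hfg] at h1
    omega
  have hRd : (- (f * g) - C ε * C (m : ZMod l) * derivative f).natDegree < l := by
    apply lt_of_le_of_lt (natDegree_sub_le _ _)
    rw [natDegree_neg, hfg]
    apply max_lt <;> omega
  rw [← hkey] at hR0 hRd
  rw [natDegree_mul hXl0 (right_ne_zero_of_mul hR0), hXl] at hRd
  omega

lemma sum_char (hl : 13 ≤ l) (p q : ZMod l) (h0 : ((fP p q) ^ (l / 2)).coeff (l - 1) = 0) :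
    ∑ x : ZMod l, quadraticChar (ZMod l) ((fP p q).eval x) = 0 := by
  have hodd : l % 2 = 1 := (Nat.Prime.eq_two_or_odd (Fact.out : l.Prime)).resolve_left (by omega)
  have hch : ringChar (ZMod l) ≠ 2 := by
    rw [ZMod.ringChar_zmod_n]; omega
  have hcast : ∀ a : ZMod l, ((quadraticChar (ZMod l) a : ℤ) : ZMod l) = a ^ (l / 2) := by
    intro a
    have := quadraticChar_eq_pow_of_char_ne_two' hch a
    rwa [ZMod.card] at this
  have hdeg : ((fP p q) ^ (l / 2)).natDegree = (l / 2) * 3 := by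
    rw [(fP_monic p q).natDegree_pow, fP_deg]
  set S := ∑ x : ZMod l, quadraticChar (ZMod l) ((fP p q).eval x) with hS
  have hS0 : ((S : ℤ) : ZMod l) = 0 := by
    rw [hS, Int.cast_sum]
    simp_rw [hcast, ← eval_pow]
    exact sum_poly (by omega) _ (by omega) h0
  have hdvd : (l : ℤ) ∣ S := (ZMod.intCast_zmod_eq_zero_iff_dvd S l).1 hS0
  have hle : ∀ a : ZMod l, quadraticChar (ZMod l) a ≤ 1 ∧ -1 ≤ quadraticChar (ZMod l) a := by
    intro a
    by_cases ha : a = 0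
    · simp [ha]
    · rcases quadraticChar_dichotomy ha with h | h <;> rw [h] <;> norm_num
  have hone : ∑ x : ZMod l, (1 : ℤ) = l := by simp
  have hneg : ∑ x : ZMod l, (-1 : ℤ) = -l := by simp
  have hup : S ≤ l := by
    rw [← hone]; exact Finset.sum_le_sum fun x _ => (hle _).1
  have hlo : -(l : ℤ) ≤ S := by
    rw [← hneg]; exact Finset.sum_le_sum fun x _ => (hle _).2
  have hne1 : S ≠ l := by
    intro h
    rw [← hone, hS] at h
    have := (Finset.sum_eq_sum_iff_of_le (fun x _ => (hle _).1)).1 h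
    apply not_const hl p q 1
    intro x
    rw [← hcast, this x (Finset.mem_univ _)]; simp
  have hne2 : S ≠ -l := by
    intro h
    rw [← hneg, hS] at h
    have := (Finset.sum_eq_sum_iff_of_le (fun x _ => (hle _).2)).1 h.symm
    apply not_const hl p q (-1)
    intro x
    rw [← hcast, ← this x (Finset.mem_univ _)]; simp
  obtain ⟨t, ht⟩ := hdvd
  have hlpos : (0 : ℤ) < l := by omega
  have : t < 1 := by
    by_contra hh
    push Not at hh
    have : S = l := le_antisymm hup (by rw [ht]; nlinarith)
    exact hne1 this
  have : -1 < t := by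
    by_contra hh
    push Not at hh
    have : S = -l := le_antisymm (by rw [ht]; nlinarith) hlo
    exact hne2 this
  have : t = 0 := by omega
  rw [ht, this, mul_zero]

lemma card_EC (hl : 13 ≤ l) (p q : ZMod l) [(EC p q).IsElliptic]
    (h0 : ∑ x : ZMod l, quadraticChar (ZMod l) (x ^ 3 + p * x + q) = 0) :
    Finite (EC p q).Point ∧ Nat.card (EC p q).Point = l + 1 := by
  have hch : ringChar (ZMod l) ≠ 2 := by
    rw [ZMod.ringChar_zmod_n]; omega
  classical
  have e1 : (EC p q).Point ≃ Option {xy : ZMod l × ZMod l // (EC p q).Equation xy.1 xy.2} :=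
    (EC p q).pointEquiv
  have e2 : {xy : ZMod l × ZMod l // (EC p q).Equation xy.1 xy.2} ≃
      Σ x : ZMod l, {y : ZMod l // y ^ 2 = x ^ 3 + p * x + q} :=
    { toFun := fun s => ⟨s.1.1, s.1.2, (EC_eq p q _ _).1 s.2⟩
      invFun := fun s => ⟨(s.1, s.2.1), (EC_eq p q _ _).2 s.2.2⟩
      left_inv := fun s => rfl
      right_inv := fun s => rfl }
  have hfin : Finite (EC p q).Point := Finite.of_equiv _ e1.symm
  refine ⟨hfin, ?_⟩
  rw [Nat.card_congr e1, Finite.card_option, Nat.card_congr e2, Nat.card_eq_fintype_card,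
    Fintype.card_sigma]
  congr 1
  have : ∀ x : ZMod l, ((Fintype.card {y : ZMod l // y ^ 2 = x ^ 3 + p * x + q} : ℕ) : ℤ) =
      quadraticChar (ZMod l) (x ^ 3 + p * x + q) + 1 := by
    intro x
    rw [← quadraticChar_card_sqrts hch]
    congr 1
    rw [Set.toFinset_card]
    rfl
  zify
  simp_rw [this]
  rw [Finset.sum_add_distrib, h0]
  simp

end count


section hasse

lemma sum_parity {K : Type*} [Field K] (g : ℕ → K) (s n : ℕ) (hs : s < 2)
    (h : ∀ r, r % 2 ≠ s → g r = 0) :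
    ∑ r ∈ Finset.range (2 * n + s + 1), g r = ∑ k ∈ Finset.range (n + 1), g (2 * k + s) := by
  induction n with
  | zero =>
    interval_cases s
    · simp
    · simp [Finset.sum_range_succ, h 0 (by norm_num)]
  | succ n ih =>
    have e : 2 * (n + 1) + s + 1 = (2 * n + s + 1) + 1 + 1 := by ring
    rw [e, Finset.sum_range_succ, Finset.sum_range_succ, ih, Finset.sum_range_succ _ (n + 1)]
    rw [h (2 * n + s + 1) (by omega)]
    have e2 : 2 * n + s + 1 + 1 = 2 * (n + 1) + s := by ring
    rw [e2, add_zero]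

lemma cop_L1 {K : Type*} [Field K] (N : ℕ) (u : K) :
    ((X + C u) ^ N * (X + C (u + 1)) ^ N : K[X]).coeff N =
      ∑ i ∈ Finset.range (N + 1), (N.choose i : K) * ((N + i).choose N : K) * u ^ i := by
  have e : (X + C (u + 1) : K[X]) = (X + C u) + 1 := by rw [C_add, C_1]; ring
  rw [e, add_pow (X + C u) 1 N, Finset.mul_sum, finsetSum_coeff]
  apply Finset.sum_congr rfl
  intro i _
  have : (X + C u) ^ N * ((X + C u) ^ i * 1 ^ (N - i) * (N.choose i : K[X])) =
      (X + C u) ^ (N + i) * C (N.choose i : K) := by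
    rw [one_pow, pow_add, C_eq_natCast]; ring
  rw [this, coeff_mul_C, coeff_X_add_C_pow, Nat.add_sub_cancel_left]
  ring

lemma cop_L2 {K : Type*} [Field K] (N : ℕ) (z w : K) :
    ((C z * X + (X ^ 2 + C w)) ^ N : K[X]).coeff N =
      ∑ r ∈ Finset.range (N + 1), (N.choose r : K) * z ^ r *
        (if 2 ∣ (N - r) then w ^ (N - r - (N - r) / 2) * ((N - r).choose ((N - r) / 2) : K) else 0) := by
  rw [add_pow, finsetSum_coeff]
  apply Finset.sum_congr rfl
  intro r hr
  have hr' : r ≤ N := by have := Finset.mem_range.1 hr; omega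
  have : (C z * X) ^ r * (X ^ 2 + C w) ^ (N - r) * (N.choose r : K[X]) =
      C ((N.choose r : K) * z ^ r) * ((X ^ 2 + C w) ^ (N - r) * X ^ r) := by
    rw [C_mul, C_pow, C_eq_natCast]; ring
  rw [this, coeff_C_mul, coeff_mul_X_pow', if_pos hr']
  congr 1
  have e : ((X ^ 2 + C w) ^ (N - r) : K[X]) = expand K 2 ((X + C w) ^ (N - r)) := by
    simp
  rw [e, coeff_expand (by norm_num)]
  split_ifs
  · rw [coeff_X_add_C_pow]
  · rfl

lemma cop_L3 {K : Type*} [Field K] (m : ℕ) (c : K) :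
    ((X ^ 3 + X ^ 2 + C c) ^ m : K[X]).coeff (2 * m) =
      ∑ i ∈ Finset.range (m + 1), (m.choose i : K) * ((m - i).choose (2 * i) : K) * c ^ i := by
  have e : (X ^ 3 + X ^ 2 + C c : K[X]) = C c + X ^ 2 * (X + 1) := by ring
  rw [e, add_pow, finsetSum_coeff]
  apply Finset.sum_congr rfl
  intro i hi
  have hi' : i ≤ m := by have := Finset.mem_range.1 hi; omega
  have : C c ^ i * (X ^ 2 * (X + 1)) ^ (m - i) * (m.choose i : K[X]) =
      C ((m.choose i : K) * c ^ i) * ((X + 1) ^ (m - i) * X ^ (2 * (m - i))) := by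
    rw [C_mul, C_pow, C_eq_natCast, mul_pow, pow_mul]; ring
  rw [this, coeff_C_mul, coeff_mul_X_pow', if_pos (by omega)]
  have e2 : 2 * m - 2 * (m - i) = 2 * i := by omega
  rw [e2, coeff_X_add_one_pow]
  ring

lemma ratio {K : Type*} [Field K] {l : ℕ} [Fact l.Prime] [CharP K l] (hl : 13 ≤ l) (N m : ℕ)
    (hm : l = 2 * m + 1) (hN : m = 3 * N ∨ m = 3 * N + 2) (i : ℕ) :
    (m.choose i : K) * ((m - i).choose (2 * i) : K) * 4 ^ i =
      (N.choose i : K) * ((N + i).choose N : K) * 27 ^ i := by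
  have hcast : ∀ a : ℕ, 0 < a → a < l → (a : K) ≠ 0 := by
    intro a h0 hal h
    rw [CharP.cast_eq_zero_iff K l] at h
    exact absurd (Nat.le_of_dvd h0 h) (by omega)
  by_cases hi : N < i
  · rw [Nat.choose_eq_zero_of_lt hi, Nat.choose_eq_zero_of_lt (show m - i < 2 * i by omega)]
    simp
  push Not at hi
  have hmK : 2 * (m : K) + 1 = 0 := by
    have := CharP.cast_eq_zero K l
    rw [hm] at this; push_cast at this; exact this
  have h2 : (2 : K) ≠ 0 := by exact_mod_cast hcast 2 (by norm_num) (by omega)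
  have h3 : (3 : K) ≠ 0 := by exact_mod_cast hcast 3 (by norm_num) (by omega)
  have hNK : 36 * (N : K) ^ 2 + 36 * N + 5 = 0 := by
    rcases hN with h | h
    · have : 6 * (N : K) + 1 = 0 := by rw [← hmK, h]; push_cast; ring
      linear_combination (6 * (N : K) + 5) * this
    · have : 6 * (N : K) + 5 = 0 := by rw [← hmK, h]; push_cast; ring
      linear_combination (6 * (N : K) + 1) * this
  induction i with
  | zero => simp
  | succ i ih =>
    have ih := ih (by omega)
    obtain ⟨t, ht⟩ : ∃ t, m = 3 * i + 3 + t := ⟨m - (3 * i + 3), by omega⟩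
    obtain ⟨s, hs⟩ : ∃ s, N = i + 1 + s := ⟨N - (i + 1), by omega⟩
    have q1 : m.choose (i + 1) * (i + 1) = m.choose i * (2 * i + 3 + t) := by
      rw [Nat.choose_succ_right_eq]; congr 1; omega
    have q2 := Nat.choose_mul_succ_eq (2 * i + 2 + t) (2 * i)
    have q3 := Nat.choose_succ_right_eq (2 * i + 2 + t) (2 * i)
    have q4 := Nat.choose_succ_right_eq (2 * i + 2 + t) (2 * i + 1)
    have q5 := Nat.choose_succ_right_eq N i
    have q6 := Nat.choose_mul_succ_eq (N + i) N
    have e1 : m - (i + 1) = 2 * i + 2 + t := by omega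
    have e2 : m - i = 2 * i + 2 + t + 1 := by omega
    have e3 : 2 * (i + 1) = 2 * i + 1 + 1 := by ring
    rw [e2] at ih
    rw [e1, e3, ← add_assoc N i 1]
    rw [show 2 * i + 2 + t + 1 - 2 * i = t + 3 by omega] at q2
    rw [show 2 * i + 2 + t - 2 * i = t + 2 by omega] at q3
    rw [show 2 * i + 2 + t - (2 * i + 1) = t + 1 by omega] at q4
    rw [show N - i = s + 1 by omega] at q5
    rw [show N + i + 1 - N = i + 1 by omega] at q6
    replace q1 := congrArg (Nat.cast : ℕ → K) q1
    replace q2 := congrArg (Nat.cast : ℕ → K) q2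
    replace q3 := congrArg (Nat.cast : ℕ → K) q3
    replace q4 := congrArg (Nat.cast : ℕ → K) q4
    replace q5 := congrArg (Nat.cast : ℕ → K) q5
    replace q6 := congrArg (Nat.cast : ℕ → K) q6
    have htK := congrArg (Nat.cast : ℕ → K) ht
    have hsK := congrArg (Nat.cast : ℕ → K) hs
    have n1 : ((i + 1 : ℕ) : K) ≠ 0 := hcast _ (by omega) (by omega)
    have n2 : ((2 * i + 1 : ℕ) : K) ≠ 0 := hcast _ (by omega) (by omega)
    have n3 : ((2 * i + 3 + t : ℕ) : K) ≠ 0 := hcast _ (by omega) (by omega)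
    push_cast at q1 q2 q3 q4 q5 q6 htK hsK n1 n2 n3
    generalize (m.choose (i + 1) : K) = A1 at *
    generalize (m.choose i : K) = A0 at *
    generalize ((2 * i + 2 + t).choose (2 * i) : K) = B0 at *
    generalize ((2 * i + 2 + t + 1).choose (2 * i) : K) = B at *
    generalize ((2 * i + 2 + t).choose (2 * i + 1) : K) = B1 at *
    generalize ((2 * i + 2 + t).choose (2 * i + 1 + 1) : K) = B2 at *
    generalize (N.choose (i + 1) : K) = D1 at *
    generalize (N.choose i : K) = D0 at *
    generalize ((N + i + 1).choose N : K) = E1 at *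
    generalize ((N + i).choose N : K) = E0 at *
    rw [pow_succ, pow_succ]
    generalize (4 : K) ^ i = P at *
    generalize (27 : K) ^ i = Q at *
    generalize (i : K) = I at *
    generalize (t : K) = T at *
    generalize (s : K) = S at *
    generalize (m : K) = Mk at *
    generalize (N : K) = Nk at *
    have hT : 2 * T = -(6 * I + 7) := by linear_combination hmK - 2 * htK
    -- b recurrence
    have r1 : A1 * B2 * ((I + 1) * (2 * I + 1) * (2 * I + 2)) = A0 * B * ((T + 3) * (T + 2) * (T + 1)) := by
      apply mul_right_cancel₀ n3
      linear_combination (B2 * (2 * I + 1) * (2 * I + 2) * (2 * I + 3 + T)) * q1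
        + A0 * (2 * I + 3 + T) ^ 2 * (2 * I + 1) * q4
        + A0 * (2 * I + 3 + T) ^ 2 * (T + 1) * q3
        + A0 * (2 * I + 3 + T) * (T + 1) * (T + 2) * q2
    have r1' : A1 * B2 * (16 * (I + 1) ^ 2) = - 3 * (6 * I + 1) * (6 * I + 5) * (A0 * B) := by
      apply mul_right_cancel₀ n2
      have x1 : 8 * ((T + 3) * (T + 2) * (T + 1)) = - ((6 * I + 1) * (6 * I + 3) * (6 * I + 5)) := by
        have : T + 3 = T + 3 := rfl
        calc 8 * ((T + 3) * (T + 2) * (T + 1)) = (2 * T + 6) * (2 * T + 4) * (2 * T + 2) := by ring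
          _ = _ := by rw [hT]; ring
      linear_combination 8 * r1 + A0 * B * x1
    have r2 : D1 * E1 * (36 * (I + 1) ^ 2) = - (6 * I + 1) * (6 * I + 5) * (D0 * E0) := by
      have y1 : D1 * E1 * (I + 1) ^ 2 = D0 * E0 * ((S + 1) * (Nk + I + 1)) := by
        linear_combination E1 * (I + 1) * q5 - D0 * (S + 1) * q6
      have y2 : 36 * ((S + 1) * (Nk + I + 1)) = - ((6 * I + 1) * (6 * I + 5)) := by
        have : S + 1 = Nk - I := by linear_combination -hsK
        rw [this]; linear_combination hNK
      linear_combination 36 * y1 + D0 * E0 * y2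
    have n4 : 4 * (I + 1) ^ 2 ≠ 0 := by
      have : (4 : K) = 2 ^ 2 := by norm_num
      rw [this]; exact mul_ne_zero (pow_ne_zero _ h2) (pow_ne_zero _ n1)
    apply mul_right_cancel₀ n4
    linear_combination P * r1' - 3 * Q * r2 - 3 * (6 * I + 1) * (6 * I + 5) * ih

lemma coeff_taylor {K : Type*} [Field K] {l : ℕ} [Fact l.Prime] [CharP K l] (g : K[X]) (r : K)
    (hg : g.natDegree < 2 * l - 1) : (g.comp (X + C r)).coeff (l - 1) = g.coeff (l - 1) := by
  have hp : l.Prime := Fact.out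
  have hl := hp.two_le
  rw [comp_eq_sum_left, Polynomial.sum_def, finsetSum_coeff]
  simp_rw [coeff_C_mul, coeff_X_add_C_pow]
  rw [Finset.sum_eq_single (l - 1)]
  · simp
  · intro e he hne
    have hed := le_natDegree_of_mem_supp e he
    rcases lt_or_gt_of_ne hne with h | h
    · rw [Nat.choose_eq_zero_of_lt h]; simp
    · have : l ∣ e.choose (l - 1) := by
        have e1 : e = (l - 1) + (e - (l - 1)) := by omega
        rw [e1]
        exact hp.dvd_choose_add (by omega) (by omega) (by omega)
      rw [(CharP.cast_eq_zero_iff K l _).2 this]; simp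
  · intro h
    rw [notMem_support_iff.1 h]; simp

lemma s_val {l : ℕ} [Fact l.Prime] (hl : 13 ≤ l) :
    ((1 - legendreSym l (-4)) / 2).toNat = if l % 4 = 1 then 0 else 1 := by
  have hodd : l % 2 = 1 := (Nat.Prime.eq_two_or_odd (Fact.out : l.Prime)).resolve_left (by omega)
  have h2 : ((2 : ℤ) : ZMod l) ≠ 0 := by
    have : ((2 : ℕ) : ZMod l) ≠ 0 := by
      intro h
      rw [ZMod.natCast_eq_zero_iff] at h
      exact absurd (Nat.le_of_dvd (by norm_num) h) (by omega)
    exact_mod_cast this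
  have e : legendreSym l (-4) = ZMod.χ₄ l := by
    have : (-4 : ℤ) = (-1) * 2 ^ 2 := by norm_num
    rw [this, legendreSym.mul, legendreSym.sq_one' l h2, mul_one,
      legendreSym.at_neg_one (by omega)]
  rw [e, ZMod.χ₄_nat_eq_if_mod_four]
  have : l % 4 = 1 ∨ l % 4 = 3 := by omega
  rcases this with h | h <;> simp [h, hodd]

lemma hasse_aux {l : ℕ} [Fact l.Prime] {K : Type*} [Field K] [IsAlgClosed K] [CharP K l]
    (φ : ZMod l →+* K) (hl : 13 ≤ l) (j k : ZMod l) (hj0 : j ≠ 0) (hj : j ≠ 1728)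
    (hk : k * (1728 - j) = j) (hss : Jl l j = 0) :
    ((fP (3 * k) (2 * k)) ^ (l / 2)).coeff (l - 1) = 0 := by
  have hprime : l.Prime := Fact.out
  have hodd : l % 2 = 1 := (Nat.Prime.eq_two_or_odd hprime).resolve_left (by omega)
  have h3l : l % 3 ≠ 0 := by
    intro h
    have := (Nat.prime_dvd_prime_iff_eq Nat.prime_three hprime).1 (Nat.dvd_of_mod_eq_zero h)
    omega
  have hcast : ∀ a : ℕ, 0 < a → a < l → (a : K) ≠ 0 := by
    intro a h0 hal h
    rw [CharP.cast_eq_zero_iff K l] at h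
    exact absurd (Nat.le_of_dvd h0 h) (by omega)
  have h2 : (2 : K) ≠ 0 := by exact_mod_cast hcast 2 (by norm_num) (by omega)
  have h3 : (3 : K) ≠ 0 := by exact_mod_cast hcast 3 (by norm_num) (by omega)
  have f2 : φ 2 = 2 := map_ofNat φ 2
  have f3 : φ 3 = 3 := map_ofNat φ 3
  have f432 : φ 432 = 432 := map_ofNat φ 432
  have f1728 : φ 1728 = 1728 := map_ofNat φ 1728
  obtain ⟨J, hJ⟩ : ∃ J, J = φ j := ⟨_, rfl⟩
  obtain ⟨κ, hκ⟩ : ∃ κ, κ = φ k := ⟨_, rfl⟩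
  have hJ0 : J ≠ 0 := by rw [hJ]; simpa using hj0
  have hJ1 : J - 1728 ≠ 0 := by
    have : J - 1728 = φ (j - 1728) := by rw [hJ, map_sub, f1728]
    rw [this]; exact (map_ne_zero φ).2 (sub_ne_zero.2 hj)
  have hκJ : κ * (1728 - J) = J := by
    have := congrArg φ hk
    simpa [hJ, hκ, f1728] using this
  obtain ⟨z, hz⟩ := IsAlgClosed.exists_pow_nat_eq ((J - 1728) / J) (n := 2) (by norm_num)
  have hz0 : z ≠ 0 := by
    rintro rfl
    exact div_ne_zero hJ1 hJ0 (by rw [← hz]; ring)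
  have hzJ : z ^ 2 * J = J - 1728 := by rw [hz]; field_simp
  have hκz : κ * z ^ 2 = -1 := by
    apply mul_right_cancel₀ hJ0
    linear_combination κ * hzJ - hκJ
  obtain ⟨c, hc⟩ : ∃ c, c * 27 = 2 * (z - 1) := ⟨2 * (z - 1) / 27, by
    have : (27 : K) = 3 ^ 3 := by norm_num
    have : (27 : K) ≠ 0 := by rw [this]; exact pow_ne_zero _ h3
    field_simp⟩
  obtain ⟨m, hm⟩ : ∃ m, m = l / 2 := ⟨_, rfl⟩
  obtain ⟨N, hN⟩ : ∃ N, N = l / 6 := ⟨_, rfl⟩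
  have hlm : l = 2 * m + 1 := by omega
  have hmN : m = 3 * N ∨ m = 3 * N + 2 := by omega
  obtain ⟨s, hs⟩ : ∃ s, s = if l % 4 = 1 then 0 else 1 := ⟨_, rfl⟩
  obtain ⟨n, hn⟩ : ∃ n, n = l / 12 := ⟨_, rfl⟩
  have hs2 : s < 2 := by rw [hs]; split_ifs <;> norm_num
  have hNs : N = 2 * n + s := by rw [hs]; split_ifs <;> omega
  -- the trinomial sum vanishes
  obtain ⟨w, hw⟩ : ∃ w, w = -432 / J := ⟨_, rfl⟩
  have hwz : z ^ 2 - 1 = 4 * w := by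
    rw [hw, hz]; field_simp; ring
  have hJl : ∑ i ∈ Finset.range (n + 1), ((2 * n + s).choose (2 * i + s) : K) *
      ((2 * n - 2 * i).choose (n - i) : K) * (-432) ^ (n - i) * (J - 1728) ^ i = 0 := by
    have := congrArg φ hss
    unfold Jl at this
    simp only [s_val hl, ← hs, ← hn] at this
    rw [map_sum, map_zero] at this
    rw [← this]
    apply Finset.sum_congr rfl
    intro i _
    simp [hJ, f432, f1728]
  have t1 : ((C z * X + (X ^ 2 + C w)) ^ N : K[X]).coeff N = 0 := by
    rw [cop_L2, hNs, sum_parity _ s n hs2]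
    · have : ∀ i ∈ Finset.range (n + 1), ((2 * n + s).choose (2 * i + s) : K) * z ^ (2 * i + s) *
        (if 2 ∣ (2 * n + s - (2 * i + s)) then w ^ (2 * n + s - (2 * i + s) - (2 * n + s - (2 * i + s)) / 2) *
          ((2 * n + s - (2 * i + s)).choose ((2 * n + s - (2 * i + s)) / 2) : K) else 0) =
        z ^ s / J ^ n * (((2 * n + s).choose (2 * i + s) : K) *
      ((2 * n - 2 * i).choose (n - i) : K) * (-432) ^ (n - i) * (J - 1728) ^ i) := by
        intro i hi
        have hi' : i ≤ n := by have := Finset.mem_range.1 hi; omega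
        have e1 : 2 * n + s - (2 * i + s) = 2 * n - 2 * i := by omega
        have e2 : (2 * n - 2 * i) / 2 = n - i := by omega
        have e3 : 2 * n - 2 * i - (n - i) = n - i := by omega
        rw [e1, e2, e3, if_pos (by omega), pow_add, pow_mul, hz, hw, div_pow, div_pow]
        have e4 : J ^ n = J ^ i * J ^ (n - i) := by rw [← pow_add]; congr 1; omega
        rw [e4]
        field_simp
      rw [Finset.sum_congr rfl this, ← Finset.mul_sum, hJl, mul_zero]
    · intro r hr
      by_cases hle : r ≤ 2 * n + s
      · rw [if_neg (by omega), mul_zero]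
      · rw [Nat.choose_eq_zero_of_lt (by omega)]; simp
  obtain ⟨u, hu⟩ : ∃ u, u * 2 = z - 1 := ⟨(z - 1) / 2, by field_simp⟩
  have t2 : ((X + C u) ^ N * (X + C (u + 1)) ^ N : K[X]).coeff N = 0 := by
    rw [← t1, ← mul_pow]
    congr 2
    have e1 : z = u + (u + 1) := by linear_combination -hu
    have e2 : w = u * (u + 1) := by
      have h4 : (4 : K) ≠ 0 := by
        have : (4 : K) = 2 ^ 2 := by norm_num
        rw [this]; exact pow_ne_zero _ h2
      apply mul_left_cancel₀ h4
      rw [← hwz, e1]; ring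
    rw [e1, e2]; simp only [C_add, C_mul, C_1]; ring
  have t3 : ((X ^ 3 + X ^ 2 + C c) ^ m : K[X]).coeff (2 * m) = 0 := by
    rw [cop_L3, ← t2, cop_L1]
    symm
    have hsub : Finset.range (N + 1) ⊆ Finset.range (m + 1) := by
      apply Finset.range_subset_range.2; omega
    rw [Finset.sum_subset hsub]
    · apply Finset.sum_congr rfl
      intro i _
      have h27 : (27 : K) ≠ 0 := by
        have : (27 : K) = 3 ^ 3 := by norm_num
        rw [this]; exact pow_ne_zero _ h3
      have hcu : c * 27 = 4 * u := by linear_combination hc - 2 * hu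
      apply mul_right_cancel₀ (pow_ne_zero i h27)
      have := ratio (K := K) hl N m hlm hmN i
      calc _ = ((N.choose i : K) * ((N + i).choose N : K) * 27 ^ i) * u ^ i := by ring
        _ = (m.choose i : K) * ((m - i).choose (2 * i) : K) * (4 * u) ^ i := by
          rw [← this, mul_pow]; ring
        _ = _ := by rw [← hcu, mul_pow]; ring
    · intro i _ hi
      rw [Nat.choose_eq_zero_of_lt (by simpa using hi)]; simp
  -- transfer
  obtain ⟨lam, hlam⟩ : ∃ lam, lam * z = -3 := ⟨-3 / z, by field_simp⟩
  have hlam0 : lam ≠ 0 := by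
    rintro rfl; apply h3; linear_combination hlam
  have g1 : lam ^ 2 = - 9 * κ := by
    apply mul_right_cancel₀ (pow_ne_zero 2 hz0)
    linear_combination (lam * z - 3) * hlam + 9 * hκz
  obtain ⟨r, hr⟩ : ∃ r : K, r * 3 = -1 := ⟨-1 / 3, by field_simp⟩
  have hcomp : ((fP (3 * k) (2 * k)).map φ).comp (C lam * X) =
      C (lam ^ 3) * ((X ^ 3 + X ^ 2 + C c : K[X]).comp (X + C r)) := by
    have e1 : (fP (3 * k) (2 * k)).map φ = X ^ 3 + C (3 * κ) * X + C (2 * κ) := by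
      simp [fP, hκ, f2, f3]
    rw [e1]
    have a1 : 3 * κ * lam = lam ^ 3 * (3 * r ^ 2 + 2 * r) := by
      have h9 : (9 : K) ≠ 0 := by
        have : (9 : K) = 3 ^ 2 := by norm_num
        rw [this]; exact pow_ne_zero _ h3
      apply mul_left_cancel₀ h3
      have : 3 * (3 * r ^ 2 + 2 * r) = -1 := by linear_combination (3 * r + 1) * hr
      linear_combination lam * g1 - lam ^ 3 * this
    have a2 : 2 * κ = lam ^ 3 * (r ^ 3 + r ^ 2 + c) := by
      have h27 : (27 : K) ≠ 0 := by
        have : (27 : K) = 3 ^ 3 := by norm_num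
        rw [this]; exact pow_ne_zero _ h3
      apply mul_left_cancel₀ h27
      have : 27 * (r ^ 3 + r ^ 2 + c) = 2 * z := by
        linear_combination (9 * r ^ 2 + 6 * r - 2) * hr + hc
      have e : lam ^ 3 * (27 * (r ^ 3 + r ^ 2 + c)) = 2 * (lam ^ 2) * (lam * z) := by
        rw [this]; ring
      rw [hlam, g1] at e
      linear_combination -e
    have b1 : (C (3 * κ) * (C lam * X) : K[X]) = C (lam ^ 3 * (3 * r ^ 2 + 2 * r)) * X := by
      rw [← a1]; simp only [C_mul]; ring
    simp only [add_comp, mul_comp, pow_comp, X_comp, C_comp]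
    rw [b1, a2]
    have c2 : (C (2 : K)) = (2 : K[X]) := rfl
    have c3 : (C (3 : K)) = (3 : K[X]) := rfl
    have hr' : (C r * 3 : K[X]) = -1 := by
      have := congrArg C hr
      rwa [C_mul, C_neg, C_1, c3] at this
    simp only [C_mul, C_add, C_pow, c2, c3]
    linear_combination (-(C lam) ^ 3 * X ^ 2) * hr'
  have hf0d : ((X ^ 3 + X ^ 2 + C c : K[X]) ^ m).natDegree < 2 * l - 1 := by
    apply lt_of_le_of_lt natDegree_pow_le
    have : (X ^ 3 + X ^ 2 + C c : K[X]).natDegree ≤ 3 := by compute_degree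
    have := Nat.mul_le_mul_left m this
    omega
  have hfin : (((fP (3 * k) (2 * k)) ^ m).map φ).coeff (l - 1) * lam ^ (l - 1) = 0 := by
    rw [← comp_C_mul_X_coeff, Polynomial.map_pow, pow_comp, hcomp, mul_pow, ← C_pow, coeff_C_mul,
      ← pow_comp, coeff_taylor _ _ hf0d]
    rw [show l - 1 = 2 * m by omega, t3, mul_zero]
  rw [← hm]
  have := (mul_eq_zero.1 hfin).resolve_right (pow_ne_zero _ hlam0)
  rw [coeff_map] at this
  simpa using this

lemma hasse {l : ℕ} [Fact l.Prime] (hl : 13 ≤ l) (j k : ZMod l) (hj0 : j ≠ 0) (hj : j ≠ 1728)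
    (hk : k * (1728 - j) = j) (hss : Jl l j = 0) :
    ((fP (3 * k) (2 * k)) ^ (l / 2)).coeff (l - 1) = 0 := by
  have : CharP (AlgebraicClosure (ZMod l)) l :=
    charP_of_injective_algebraMap (algebraMap (ZMod l) (AlgebraicClosure (ZMod l))).injective l
  exact hasse_aux (algebraMap (ZMod l) (AlgebraicClosure (ZMod l))) hl j k hj0 hj hk hss

end hasse

section final
open WeierstrassCurve

lemma tor7_scale {F : Type*} [Field F] (D x A B : F) (hD : D ≠ 0) :
    tor7 (D * x) (D ^ 3 * A) (D ^ 2 * B) ↔ tor7 x A B := by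
  by_cases hA : A = 0
  · simp [tor7, hA]
  by_cases h2 : (2 : F) = 0
  · have h4 : (4 : F) = 0 := by linear_combination 2 * h2
    have e1 : tM (D * x) (D ^ 3 * A) (D ^ 2 * B) = D * tM x A B := by
      unfold tM; rw [h4]; simp; ring
    unfold tor7 tb tc
    rw [e1, h4, h2]
    simp [hD, hA]
  have h4 : (4 : F) ≠ 0 := by
    have : (4 : F) = 2 ^ 2 := by norm_num
    rw [this]; exact pow_ne_zero _ h2
  have e1 : tM (D * x) (D ^ 3 * A) (D ^ 2 * B) = D * tM x A B := by
    unfold tM; field_simp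
  have e2 : tb (D * x) (D ^ 3 * A) (D ^ 2 * B) = tb x A B := by
    unfold tb; rw [e1]; field_simp
  have e3 : tc (D * x) (D ^ 3 * A) (D ^ 2 * B) = tc x A B := by
    unfold tc; rw [e1]; field_simp
  unfold tor7
  rw [e1, e2, e3]
  simp [hD]

lemma exists_cub {l : ℕ} [Fact l.Prime] (h7 : l % 7 = 6) : ∃ a : ZMod l, cub a = 0 := by
  have : CharP (AlgebraicClosure (ZMod l)) l :=
    charP_of_injective_algebraMap (algebraMap (ZMod l) (AlgebraicClosure (ZMod l))).injective l
  obtain ⟨z, hz⟩ := IsAlgClosed.exists_root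
    (X ^ 6 + X ^ 5 + X ^ 4 + X ^ 3 + X ^ 2 + X + 1 : (AlgebraicClosure (ZMod l))[X]) (by
      have : (X ^ 6 + X ^ 5 + X ^ 4 + X ^ 3 + X ^ 2 + X + 1 :
        (AlgebraicClosure (ZMod l))[X]).degree = 6 := by compute_degree!
      rw [this]; norm_num)
  simp only [IsRoot, eval_add, eval_pow, eval_X, eval_one] at hz
  have hz7 : z ^ 7 = 1 := by linear_combination (z - 1) * hz
  have hz0 : z ≠ 0 := by rintro rfl; simp at hz7
  have hη : z + z ^ 6 ∈ (⊥ : Subfield (AlgebraicClosure (ZMod l))) := by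
    rw [Subfield.mem_bot_iff_pow_eq_self _ l, add_pow_char]
    obtain ⟨t, ht⟩ : ∃ t, l = 7 * t + 6 := ⟨l / 7, by omega⟩
    have e : z ^ l = z ^ 6 := by
      conv_lhs => arg 2; rw [ht]
      rw [pow_add, pow_mul, hz7, one_pow, one_mul]
    rw [← pow_mul, mul_comm, pow_mul, e]
    linear_combination (z * (z ^ 28 + z ^ 21 + z ^ 14 + z ^ 7 + 1)) * hz7
  rw [mem_bot_iff_intCast l] at hη
  obtain ⟨n, hn⟩ := hη
  refine ⟨2 + 3 * (n : ZMod l) + (n : ZMod l) ^ 2, ?_⟩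
  apply (algebraMap (ZMod l) (AlgebraicClosure (ZMod l))).injective
  have f8 : algebraMap (ZMod l) (AlgebraicClosure (ZMod l)) 8 = 8 := map_ofNat _ 8
  have f5 : algebraMap (ZMod l) (AlgebraicClosure (ZMod l)) 5 = 5 := map_ofNat _ 5
  have f3 : algebraMap (ZMod l) (AlgebraicClosure (ZMod l)) 3 = 3 := map_ofNat _ 3
  have f2 : algebraMap (ZMod l) (AlgebraicClosure (ZMod l)) 2 = 2 := map_ofNat _ 2
  simp only [cub, map_add, map_sub, map_mul, map_pow, map_intCast, f8, f5, f3, f2, map_one,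
    map_zero]
  have hη3 : (n : AlgebraicClosure (ZMod l)) ^ 3 + (n : AlgebraicClosure (ZMod l)) ^ 2
      - 2 * (n : AlgebraicClosure (ZMod l)) - 1 = 0 := by
    rw [hn]
    linear_combination ((-1) * z ^ 0 + (-1) * z ^ 1 + (3) * z ^ 2 + (-1) * z ^ 4 + (-2) * z ^ 6 + (3) * z ^ 7 + (-1) * z ^ 11 + (1) * z ^ 12) * hz
  generalize (n : AlgebraicClosure (ZMod l)) = e at *
  linear_combination ((13) * e ^ 0 + (19) * e ^ 1 + (8) * e ^ 2 + (1) * e ^ 3) * hη3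

lemma card_tors {G : Type*} [AddCommGroup G] [Finite G] (h : 7 ∣ Nat.card G) :
    ∃ a, 1 ≤ a ∧ Nat.card {P : G // 7 • P = 0} = 7 ^ a := by
  have : Fact (Nat.Prime 7) := ⟨by norm_num⟩
  let S : AddSubgroup G := (nsmulAddMonoidHom (α := G) 7).ker
  have hS : ∀ P : G, P ∈ S ↔ 7 • P = 0 := fun P => by
    simp [S, AddMonoidHom.mem_ker]
  letI : Module (ZMod 7) S := AddCommGroup.zmodModule (n := 7) (by
    intro x
    apply Subtype.ext
    exact (hS x.1).1 x.2)
  have hc : Nat.card {P : G // 7 • P = 0} = Nat.card S :=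
    Nat.card_congr (Equiv.subtypeEquivRight (fun P => (hS P).symm))
  have hp : Nat.card S = 7 ^ Module.finrank (ZMod 7) S := by
    letI := Fintype.ofFinite S
    rw [Nat.card_eq_fintype_card, Module.card_eq_pow_finrank (K := ZMod 7), ZMod.card]
  refine ⟨Module.finrank (ZMod 7) S, ?_, by rw [hc, hp]⟩
  rw [Nat.one_le_iff_ne_zero]
  intro h0
  rw [h0, pow_zero] at hp
  obtain ⟨P, hP⟩ := exists_prime_addOrderOf_dvd_card' (G := G) 7 h
  have hPS : P ∈ S := (hS P).2 (by rw [← hP]; exact addOrderOf_nsmul_eq_zero P)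
  have : Subsingleton S := (Nat.card_eq_one_iff_unique.1 hp).1
  have : (⟨P, hPS⟩ : S) = 0 := Subsingleton.elim _ _
  have : P = 0 := congrArg Subtype.val this
  rw [this] at hP
  simp at hP

variable {l : ℕ} [Fact l.Prime]

lemma two_ne : ∀ a : ℕ, 0 < a → a < l → (a : ZMod l) ≠ 0 := by
  intro a h0 hal h
  rw [ZMod.natCast_eq_zero_iff] at h
  exact absurd (Nat.le_of_dvd h0 h) (by omega)

open Classical in
lemma tors_count (hl : 13 ≤ l) (h7 : l % 7 = 6) (p q : ZMod l) [(EC p q).IsElliptic]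
    (h0 : ∑ x : ZMod l, quadraticChar (ZMod l) (x ^ 3 + p * x + q) = 0) :
    ∃ a, 1 ≤ a ∧ 2 * (Finset.univ.filter (fun x : ZMod l =>
      tor7 x (x ^ 3 + p * x + q) (3 * x ^ 2 + p) ∧ IsSquare (x ^ 3 + p * x + q))).card + 1
        = 7 ^ a := by
  have hch : ringChar (ZMod l) ≠ 2 := by
    rw [ZMod.ringChar_zmod_n]; omega
  have h2 : (2 : ZMod l) ≠ 0 := by exact_mod_cast two_ne 2 (by norm_num) (by omega)
  obtain ⟨hfin, hcard⟩ := card_EC hl p q h0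
  obtain ⟨a, ha, hca⟩ := card_tors (G := (EC p q).Point) (by rw [hcard]; omega)
  refine ⟨a, ha, ?_⟩
  rw [← hca]
  have hns : ∀ x y : ZMod l, y ^ 2 = x ^ 3 + p * x + q → (EC p q).Nonsingular x y :=
    fun x y h => (Affine.equation_iff_nonsingular).1 ((EC_eq p q x y).2 h)
  let V := Σ x : {x : ZMod l // tor7 x (x ^ 3 + p * x + q) (3 * x ^ 2 + p)},
    {y : ZMod l // y ^ 2 = x.1 ^ 3 + p * x.1 + q}
  let g : Option V → {P : (EC p q).Point // 7 • P = 0} := fun o =>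
    match o with
    | none => ⟨0, nsmul_zero 7⟩
    | some v => ⟨Affine.Point.some v.1.1 v.2.1 (hns _ _ v.2.2), (crit h2 _).2 v.1.2⟩
  have hg : Function.Bijective g := by
    constructor
    · rintro (_ | ⟨⟨x, hx⟩, ⟨y, hy⟩⟩) (_ | ⟨⟨x', hx'⟩, ⟨y', hy'⟩⟩) h
      · rfl
      · exact absurd (congrArg Subtype.val h).symm (Affine.Point.some_ne_zero _)
      · exact absurd (congrArg Subtype.val h) (Affine.Point.some_ne_zero _)
      · have := congrArg Subtype.val h
        simp only [g, Affine.Point.some.injEq] at this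
        obtain ⟨rfl, rfl⟩ := this
        rfl
    · rintro ⟨P, hP⟩
      rcases P with _ | ⟨x, y, h⟩
      · exact ⟨none, rfl⟩
      · exact ⟨some ⟨⟨x, (crit h2 h).1 hP⟩, ⟨y, (EC_eq p q x y).1 h.1⟩⟩, rfl⟩
  rw [← Nat.card_congr (Equiv.ofBijective g hg), Finite.card_option]
  congr 1
  rw [Nat.card_eq_fintype_card, Fintype.card_sigma]
  have : ∀ x : {x : ZMod l // tor7 x (x ^ 3 + p * x + q) (3 * x ^ 2 + p)},
      Fintype.card {y : ZMod l // y ^ 2 = x.1 ^ 3 + p * x.1 + q} =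
      if IsSquare (x.1 ^ 3 + p * x.1 + q) then 2 else 0 := by
    intro x
    have e : ((Fintype.card {y : ZMod l // y ^ 2 = x.1 ^ 3 + p * x.1 + q} : ℕ) : ℤ) =
      quadraticChar (ZMod l) (x.1 ^ 3 + p * x.1 + q) + 1 := by
      rw [← quadraticChar_card_sqrts hch]
      congr 1
      rw [Set.toFinset_card]
      apply Fintype.card_congr
      rfl
    split_ifs with hs
    · rw [(quadraticChar_one_iff_isSquare x.2.1).2 hs] at e
      omega
    · rw [quadraticChar_neg_one_iff_not_isSquare.2 hs] at e
      omega
  rw [Finset.sum_congr rfl (fun x _ => this x)]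
  rw [← Finset.sum_subtype (Finset.univ.filter (fun x : ZMod l =>
    tor7 x (x ^ 3 + p * x + q) (3 * x ^ 2 + p))) (by simp)
    (fun x : ZMod l => if IsSquare (x ^ 3 + p * x + q) then 2 else 0)]
  rw [← Finset.sum_filter, Finset.filter_filter, Finset.sum_const, smul_eq_mul, mul_comm]

lemma EC_ell (hl : 13 ≤ l) (k D : ZMod l) (hk : k ≠ 0) (hk1 : k + 1 ≠ 0) (hD : D ≠ 0) :
    (EC (3 * k * D ^ 2) (2 * k * D ^ 3)).IsElliptic := by
  have h2 : (2 : ZMod l) ≠ 0 := by exact_mod_cast two_ne 2 (by norm_num) (by omega)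
  have h3 : (3 : ZMod l) ≠ 0 := by exact_mod_cast two_ne 3 (by norm_num) (by omega)
  constructor
  rw [isUnit_iff_ne_zero]
  have : (EC (3 * k * D ^ 2) (2 * k * D ^ 3)).Δ = - 2 ^ 6 * 3 ^ 3 * k ^ 2 * (k + 1) * D ^ 6 := by
    simp only [WeierstrassCurve.Δ, WeierstrassCurve.b₂, WeierstrassCurve.b₄,
      WeierstrassCurve.b₆, WeierstrassCurve.b₈, EC]
    ring
  rw [this]
  have := mul_ne_zero (mul_ne_zero (mul_ne_zero (mul_ne_zero (pow_ne_zero 6 h2)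
    (pow_ne_zero 3 h3)) (pow_ne_zero 2 hk)) hk1) (pow_ne_zero 6 hD)
  intro h
  apply this
  linear_combination -h

open Classical in
lemma T_count (hl : 13 ≤ l) (h7 : l % 7 = 6) (k : ZMod l) (hk : k ≠ 0) (hk1 : k + 1 ≠ 0)
    (h0 : ((fP (3 * k) (2 * k)) ^ (l / 2)).coeff (l - 1) = 0) :
    ∃ a b, 1 ≤ a ∧ 1 ≤ b ∧ 2 * (Finset.univ.filter (fun x : ZMod l =>
      tor7 x (x ^ 3 + 3 * k * x + 2 * k) (3 * x ^ 2 + 3 * k))).card + 2 = 7 ^ a + 7 ^ b := by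
  have hch : ringChar (ZMod l) ≠ 2 := by
    rw [ZMod.ringChar_zmod_n]; omega
  obtain ⟨D, hD⟩ := FiniteField.exists_nonsquare hch
  have hD0 : D ≠ 0 := by rintro rfl; exact hD IsSquare.zero
  have hχD := quadraticChar_neg_one_iff_not_isSquare.2 hD
  have hs := sum_char hl _ _ h0
  simp_rw [fP_eval] at hs
  have hE1 : (EC (3 * k) (2 * k)).IsElliptic := by
    have := EC_ell hl k 1 hk hk1 one_ne_zero
    simpa using this
  have hE2 := EC_ell hl k D hk hk1 hD0
  obtain ⟨a, ha, hca⟩ := tors_count hl h7 (3 * k) (2 * k) hs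
  have sc1 : ∀ x : ZMod l, (D * x) ^ 3 + 3 * k * D ^ 2 * (D * x) + 2 * k * D ^ 3 =
      D ^ 3 * (x ^ 3 + 3 * k * x + 2 * k) := fun x => by ring
  have sc2 : ∀ x : ZMod l, 3 * (D * x) ^ 2 + 3 * k * D ^ 2 = D ^ 2 * (3 * x ^ 2 + 3 * k) :=
    fun x => by ring
  have ev : ∀ x : ZMod l, Equiv.mulLeft₀ D hD0 x = D * x := fun _ => rfl
  obtain ⟨b, hb, hcb⟩ := tors_count hl h7 (3 * k * D ^ 2) (2 * k * D ^ 3) (by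
    rw [← Equiv.sum_comp (Equiv.mulLeft₀ D hD0)]
    simp only [ev, sc1, map_mul]
    rw [← Finset.mul_sum, hs, mul_zero])
  refine ⟨a, b, ha, hb, ?_⟩
  rw [← hca, ← hcb]
  have hsq : ∀ A : ZMod l, A ≠ 0 → (IsSquare (D ^ 3 * A) ↔ ¬ IsSquare A) := by
    intro A hA
    rw [← quadraticChar_one_iff_isSquare (mul_ne_zero (pow_ne_zero 3 hD0) hA),
      ← quadraticChar_neg_one_iff_not_isSquare, map_mul, map_pow, hχD]
    constructor <;> intro h <;> linarith
  have e2 : (Finset.univ.filter (fun x : ZMod l =>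
      tor7 x (x ^ 3 + 3 * k * D ^ 2 * x + 2 * k * D ^ 3) (3 * x ^ 2 + 3 * k * D ^ 2) ∧
        IsSquare (x ^ 3 + 3 * k * D ^ 2 * x + 2 * k * D ^ 3))).card =
      (Finset.univ.filter (fun x : ZMod l =>
        tor7 x (x ^ 3 + 3 * k * x + 2 * k) (3 * x ^ 2 + 3 * k) ∧
        ¬ IsSquare (x ^ 3 + 3 * k * x + 2 * k))).card := by
    symm
    apply Finset.card_equiv (Equiv.mulLeft₀ D hD0)
    intro x
    simp only [Finset.mem_filter, Finset.mem_univ, true_and, ev, sc1, sc2,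
      tor7_scale D x _ _ hD0]
    constructor
    · rintro ⟨h1, h2⟩; exact ⟨h1, (hsq _ h1.1).2 h2⟩
    · rintro ⟨h1, h2⟩; exact ⟨h1, (hsq _ h1.1).1 h2⟩
  rw [e2, ← Finset.filter_filter, ← Finset.filter_filter]
  have := Finset.card_filter_add_card_filter_not (s := Finset.univ.filter (fun x : ZMod l =>
      tor7 x (x ^ 3 + 3 * k * x + 2 * k) (3 * x ^ 2 + 3 * k)))
      (fun x : ZMod l => IsSquare (x ^ 3 + 3 * k * x + 2 * k))
  omega

lemma Gxj_eval (j x : ZMod l) : (Gxj l j).eval x =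
    qq x ^ 3 * sex x ^ 3 - j * (x * (x - 1) * cub x ^ 7) := by
  simp only [Gxj, qq, sex, cub, eval_sub, eval_mul, eval_pow, eval_add, eval_X, eval_C, eval_one,
    eval_ofNat]

lemma Gxj_deg (j : ZMod l) : (Gxj l j).natDegree ≤ 24 := by
  unfold Gxj; compute_degree

open Classical in
lemma main (hl : 13 ≤ l) (h7 : l % 7 = 6)
    (j : ZMod l) (hj0 : j ≠ 0) (hj : j ≠ 1728) (hss : Jl l j = 0) :
    (Gxj l j).roots.toFinset.card = 6 := by
  have h2 : (2 : ZMod l) ≠ 0 := by exact_mod_cast two_ne 2 (by norm_num) (by omega)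
  have h3 : (3 : ZMod l) ≠ 0 := by exact_mod_cast two_ne 3 (by norm_num) (by omega)
  have hs7 : (7 : ZMod l) ≠ 0 := by exact_mod_cast two_ne 7 (by norm_num) (by omega)
  have h1728 : (1728 : ZMod l) ≠ 0 := by
    have : (1728 : ZMod l) = 2 ^ 6 * 3 ^ 3 := by norm_num
    rw [this]; exact mul_ne_zero (pow_ne_zero _ h2) (pow_ne_zero _ h3)
  have hj' : 1728 - j ≠ 0 := sub_ne_zero.2 hj.symm
  obtain ⟨k, hk⟩ : ∃ k, k * (1728 - j) = j := ⟨j / (1728 - j), div_mul_cancel₀ _ hj'⟩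
  have hk0 : k ≠ 0 := by
    rintro rfl
    exact hj0 (by rw [← hk, zero_mul])
  have hk1 : k + 1 ≠ 0 := by
    intro h
    apply h1728
    linear_combination (1728 - j) * h - hk
  obtain ⟨a, ha⟩ := exists_cub h7
  obtain ⟨s, t, hs, ht, hcount⟩ := T_count hl h7 k hk0 hk1 (hasse hl j k hj0 hj hk hss)
  have c1 : (Finset.univ.filter (fun x : ZMod l =>
      tor7 x (x ^ 3 + 3 * k * x + 2 * k) (3 * x ^ 2 + 3 * k))).card =
      (Finset.univ.filter (fun d : ZMod l => R1 j d)).card := by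
    refine Finset.card_bij'
      (fun x _ => tb x (x ^ 3 + 3 * k * x + 2 * k) (3 * x ^ 2 + 3 * k) /
        tc x (x ^ 3 + 3 * k * x + 2 * k) (3 * x ^ 2 + 3 * k))
      (fun d _ => b2 d * c4 d / c6 d) ?_ ?_ ?_ ?_
    · intro x hx
      simp only [Finset.mem_filter, Finset.mem_univ, true_and] at hx ⊢
      exact (d_of_T h2 h3 hk0 hk hx).1
    · intro d hd
      simp only [Finset.mem_filter, Finset.mem_univ, true_and] at hd ⊢
      exact (T_of_d h2 h3 hs7 hj0 hj hk0 hk hd).1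
    · intro x hx
      simp only [Finset.mem_filter, Finset.mem_univ, true_and] at hx
      exact (d_of_T h2 h3 hk0 hk hx).2.symm
    · intro d hd
      simp only [Finset.mem_filter, Finset.mem_univ, true_and] at hd
      exact (T_of_d h2 h3 hs7 hj0 hj hk0 hk hd).2
  have c2 : (Finset.univ.filter (fun x : ZMod l => Groot j x)).card =
      (Finset.univ.filter (fun d : ZMod l => R1 j d)).card := by
    refine Finset.card_bij' (fun x _ => Wm a x) (fun x _ => Wm a x) ?_ ?_ ?_ ?_
    · intro x hx
      simp only [Finset.mem_filter, Finset.mem_univ, true_and] at hx ⊢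
      have hxa : x ≠ a := by rintro rfl; exact G_ne hs7 ha hx
      exact (G_iff_R1 hs7 ha hxa).1 hx
    · intro d hd
      simp only [Finset.mem_filter, Finset.mem_univ, true_and] at hd ⊢
      have hda : d ≠ a := by rintro rfl; exact R1_ne hs7 ha hd
      rw [G_iff_R1 hs7 ha (Wm_ne hs7 ha hda), Wm_Wm hs7 ha hda]
      exact hd
    · intro x hx
      simp only [Finset.mem_filter, Finset.mem_univ, true_and] at hx
      have hxa : x ≠ a := by rintro rfl; exact G_ne hs7 ha hx
      exact Wm_Wm hs7 ha hxa
    · intro d hd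
      simp only [Finset.mem_filter, Finset.mem_univ, true_and] at hd
      have hda : d ≠ a := by rintro rfl; exact R1_ne hs7 ha hd
      exact Wm_Wm hs7 ha hda
  have hG0 : Gxj l j ≠ 0 := by
    intro h
    apply G_ne (j := j) hs7 ha
    have := Gxj_eval j a
    rw [h, eval_zero] at this
    unfold Groot
    exact sub_eq_zero.1 this.symm
  have c3 : (Gxj l j).roots.toFinset.card =
      (Finset.univ.filter (fun x : ZMod l => Groot j x)).card := by
    congr 1
    ext x
    rw [Multiset.mem_toFinset, mem_roots hG0, IsRoot, Gxj_eval, sub_eq_zero]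
    simp only [Finset.mem_filter, Finset.mem_univ, true_and]
    rfl
  have hle : (Gxj l j).roots.toFinset.card ≤ 24 :=
    (Multiset.toFinset_card_le _).trans ((card_roots' _).trans (Gxj_deg j))
  rw [← c2.trans c1.symm, ← c3] at hcount
  have hs1 : s = 1 := by
    by_contra hne
    have e1 := Nat.pow_le_pow_right (n := 7) (by norm_num) (show 2 ≤ s by omega)
    have e2 := Nat.pow_le_pow_right (n := 7) (by norm_num) ht
    omega
  have ht1 : t = 1 := by
    by_contra hne
    have e1 := Nat.pow_le_pow_right (n := 7) (by norm_num) (show 2 ≤ t by omega)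
    have e2 := Nat.pow_le_pow_right (n := 7) (by norm_num) hs
    omega
  rw [hs1, ht1] at hcount
  omega

end final

end G7

/-- Theorem 7(a): for a prime `l ≡ 6 (mod 7)` and a supersingular `j`-invariant
`j ∈ 𝔽_l` with `j ≠ 0, 1728`, the polynomial `G(x,j)` has exactly `6` distinct
roots in `𝔽_l`. -/
theorem Gxj_six_roots (l : ℕ) [Fact (Nat.Prime l)] (h7 : l % 7 = 6)
    (j : ZMod l) (hj0 : j ≠ 0) (hj1728 : j ≠ 1728) (hss : Jl l j = 0) :
    (Gxj l j).roots.toFinset.card = 6 := by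
  have hp : l.Prime := Fact.out
  have hl : 13 ≤ l := by
    by_contra h
    have h6 : l = 6 := by omega
    rw [h6] at hp
    norm_num at hp
  convert G7.main hl h7 j hj0 hj1728 hss
end
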